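/- Let f : ℝ² → ℝ² be a differentiable map such that f(0) = 0 and Spec(f) ∩ ([0, ε) ∪ [1, 1+ε)) = ∅ for some ε > 0. Then f is a topological embedding and Fix(f) = {0}. -/

import Mathlib

open Topology Filter Metric Set Function

noncomputable section

/-- The plane with the Euclidean norm. -/
abbrev Plane : Type := EuclideanSpace ℝ (Fin 2)

/-- `z : ℂ` is a complex eigenvalue of the continuous `ℝ`-linear map `L : ℝ² → ℝ²`,
i.e. a root of the characteristic polynomial of its matrix in the standard basis. -/
def IsEigenvalueCLM (L : Plane →L[ℝ] Plane) (z : ℂ) : Prop :=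
  (((LinearMap.toMatrix (EuclideanSpace.basisFun (Fin 2) ℝ).toBasis
      (EuclideanSpace.basisFun (Fin 2) ℝ).toBasis) L.toLinearMap).map
      (algebraMap ℝ ℂ)).charpoly.IsRoot z

/-- `Spec` of a map whose derivative at each point `p` is `Df p`: the set of all complex
eigenvalues of all the derivatives. -/
def spec (Df : Plane → Plane →L[ℝ] Plane) : Set ℂ :=
  {z | ∃ p : Plane, IsEigenvalueCLM (Df p) z}



lemma angle_aux {X : Type*} [TopologicalSpace X] {K : Set X} (hK : IsPreconnected K) {θ : X → ℝ}
    (hθ : ContinuousOn θ K) (α : ℝ) (h : ∀ x ∈ K, 0 < Real.cos (θ x - α)) :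
    ∃ k : ℤ, ∀ x ∈ K, |θ x - α - 2 * Real.pi * k| < Real.pi / 2 := by
  rcases K.eq_empty_or_nonempty with rfl | ⟨x0, hx0⟩
  · exact ⟨0, by simp⟩
  have hpi := Real.pi_pos
  have hc : ∀ x ∈ K, ∀ k : ℤ, 0 < Real.cos (|θ x - α - 2 * Real.pi * k|) := by
    intro x hx k
    rw [Real.cos_abs]
    have := Real.cos_sub_int_mul_two_pi (θ x - α) k
    rw [show θ x - α - 2 * Real.pi * k = θ x - α - k * (2 * Real.pi) by ring, this]
    exact h x hx
  set k : ℤ := round ((θ x0 - α) / (2 * Real.pi)) with hk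
  refine ⟨k, ?_⟩
  have h0 : |θ x0 - α - 2 * Real.pi * k| ≤ Real.pi := by
    have := abs_sub_round ((θ x0 - α) / (2 * Real.pi))
    have h2 : θ x0 - α - 2 * Real.pi * k = (2 * Real.pi) * ((θ x0 - α) / (2 * Real.pi) - k) := by
      field_simp
    rw [h2, abs_mul, abs_of_pos (by positivity)]
    nlinarith
  have h1 : |θ x0 - α - 2 * Real.pi * k| < Real.pi / 2 := by
    by_contra hcon
    push Not at hcon
    have := hc x0 hx0 k
    have h3 := Real.cos_nonpos_of_pi_div_two_le_of_le hcon (by linarith)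
    linarith
  intro x hx
  by_contra hcon
  push Not at hcon
  have hcont : ContinuousOn (fun x => |θ x - α - 2 * Real.pi * k|) K := by fun_prop
  obtain ⟨y, hy, hy2⟩ := hK.intermediate_value hx0 hx hcont ⟨h1.le, hcon⟩
  have := hc y hy k
  simp only at hy2
  rw [hy2, Real.cos_pi_div_two] at this
  exact lt_irrefl _ this

lemma int_aux (x : ℝ) (n : ℤ) (h1 : |2 * Real.pi * n + x| < Real.pi) (h2 : |x| < Real.pi) : n = 0 := by
  have hpi := Real.pi_pos
  rw [abs_lt] at *
  have a : (n : ℝ) < 1 := by nlinarith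
  have b : (-1 : ℝ) < n := by nlinarith
  have a' : n < 1 := by exact_mod_cast a
  have b' : -1 < n := by exact_mod_cast b
  omega

theorem miranda {a b c d : ℝ} (hab : a ≤ b) (hcd : c ≤ d) {F G : ℝ → ℝ → ℝ}
    (hF : ContinuousOn (uncurry F) (Icc a b ×ˢ Icc c d))
    (hG : ContinuousOn (uncurry G) (Icc a b ×ˢ Icc c d))
    (hl : ∀ t ∈ Icc c d, F a t < 0) (hr : ∀ t ∈ Icc c d, 0 < F b t)
    (hb : ∀ s ∈ Icc a b, G s c < 0) (ht : ∀ s ∈ Icc a b, 0 < G s d) :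
    ∃ s ∈ Icc a b, ∃ t ∈ Icc c d, F s t = 0 ∧ G s t = 0 := by
  by_contra hcon
  push Not at hcon
  set P : ℝ × ℝ → ℝ × ℝ := fun p => (projIcc a b hab p.1, projIcc c d hcd p.2) with hP
  have hPc : Continuous P := by
    refine Continuous.prodMk ?_ ?_
    · exact continuous_subtype_val.comp (continuous_projIcc.comp continuous_fst)
    · exact continuous_subtype_val.comp (continuous_projIcc.comp continuous_snd)
  have hPm : ∀ p, P p ∈ Icc a b ×ˢ Icc c d := fun p => ⟨(projIcc a b hab p.1).2, (projIcc c d hcd p.2).2⟩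
  have hPid : ∀ p ∈ Icc a b ×ˢ Icc c d, P p = p := by
    rintro ⟨s, t⟩ ⟨hs, ht⟩
    simp only [hP]
    rw [projIcc_of_mem hab hs, projIcc_of_mem hcd ht]
  have hFP : Continuous (fun p => uncurry F (P p)) := hF.comp_continuous hPc hPm
  have hGP : Continuous (fun p => uncurry G (P p)) := hG.comp_continuous hPc hPm
  set g : ℝ × ℝ → ℂ := fun p => ((uncurry F (P p) : ℝ) : ℂ) + ((uncurry G (P p) : ℝ) : ℂ) * Complex.I with hg
  have hgc : Continuous g :=
    (Complex.continuous_ofReal.comp hFP).add ((Complex.continuous_ofReal.comp hGP).mul continuous_const)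
  have hg0 : (0 : ℂ) ∉ g '' univ := by
    rintro ⟨p, -, hp⟩
    have h1 := congrArg Complex.re hp
    have h2 := congrArg Complex.im hp
    simp [hg] at h1 h2
    exact hcon _ (hPm p).1 _ (hPm p).2 h1 h2
  obtain ⟨L, hLc, hL⟩ := Complex.exists_continuousOn_eqOn_exp_comp (U := (univ : Set (ℝ × ℝ)))
    (by
      have : ContractibleSpace (univ : Set (ℝ × ℝ)) := convex_univ.contractibleSpace ⟨0, mem_univ _⟩
      exact (inferInstance : SimplyConnectedSpace (univ : Set (ℝ × ℝ)))) isOpen_univ hgc.continuousOn hg0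
  set θ : ℝ × ℝ → ℝ := fun p => (L p).im with hθ
  have hθc : Continuous θ := Complex.continuous_im.comp (continuousOn_univ.1 hLc)
  have hre : ∀ p ∈ Icc a b ×ˢ Icc c d, uncurry F p = Real.exp (L p).re * Real.cos (θ p) := by
    intro p hp
    have := congrArg Complex.re (hL (mem_univ p))
    simp [hg, Complex.exp_re, hPid p hp] at this
    exact this.symm
  have him : ∀ p ∈ Icc a b ×ˢ Icc c d, uncurry G p = Real.exp (L p).re * Real.sin (θ p) := by
    intro p hp
    have := congrArg Complex.im (hL (mem_univ p))
    simp [hg, Complex.exp_im, hPid p hp] at this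
    exact this.symm
  have key : ∀ K : Set (ℝ × ℝ), ∀ α, IsPreconnected K → (∀ x ∈ K, 0 < Real.cos (θ x - α)) →
    ∃ k : ℤ, ∀ x ∈ K, |θ x - α - 2 * Real.pi * k| < Real.pi / 2 :=
    fun K α hK h => angle_aux hK hθc.continuousOn α h
  have hpi := Real.pi_pos
  have pos_of : ∀ x y : ℝ, 0 < Real.exp x * y → 0 < y := fun x y h =>
    (mul_pos_iff_of_pos_left (Real.exp_pos x)).1 h
  obtain ⟨kr, hkr⟩ := key ({b} ×ˢ Icc c d) 0 (isPreconnected_singleton.prod isPreconnected_Icc) (by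
    rintro ⟨s, t⟩ ⟨hs, h⟩
    obtain rfl : s = b := hs
    have h2 := hre (s, t) ⟨⟨hab, le_rfl⟩, h⟩
    have := hr t h
    simp only [uncurry] at h2
    rw [h2] at this
    rw [sub_zero]
    exact pos_of _ _ this)
  obtain ⟨kt, hkt⟩ := key (Icc a b ×ˢ {d}) (Real.pi/2) (isPreconnected_Icc.prod isPreconnected_singleton) (by
    rintro ⟨s, t⟩ ⟨h, hs⟩
    obtain rfl : t = d := hs
    have h2 := him (s, t) ⟨h, ⟨hcd, le_rfl⟩⟩
    have := ht s h
    simp only [uncurry] at h2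
    rw [h2] at this
    rw [Real.cos_sub_pi_div_two]
    exact pos_of _ _ this)
  obtain ⟨kl, hkl⟩ := key ({a} ×ˢ Icc c d) Real.pi (isPreconnected_singleton.prod isPreconnected_Icc) (by
    rintro ⟨s, t⟩ ⟨hs, h⟩
    obtain rfl : s = a := hs
    have h2 := hre (s, t) ⟨⟨le_rfl, hab⟩, h⟩
    have := hl t h
    simp only [uncurry] at h2
    rw [h2] at this
    rw [Real.cos_sub_pi]
    refine pos_of (L (s,t)).re _ ?_
    linarith)
  obtain ⟨kb, hkb⟩ := key (Icc a b ×ˢ {c}) (Real.pi/2 + Real.pi) (isPreconnected_Icc.prod isPreconnected_singleton) (by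
    rintro ⟨s, t⟩ ⟨h, hs⟩
    obtain rfl : t = c := hs
    have h2 := him (s, t) ⟨h, ⟨le_rfl, hcd⟩⟩
    have := hb s h
    simp only [uncurry] at h2
    rw [h2] at this
    rw [← sub_sub, Real.cos_sub_pi, Real.cos_sub_pi_div_two]
    refine pos_of (L (s,t)).re _ ?_
    linarith)
  have A1 := hkr (b, d) ⟨rfl, ⟨hcd, le_rfl⟩⟩
  have A2 := hkt (b, d) ⟨⟨hab, le_rfl⟩, rfl⟩
  have B1 := hkt (a, d) ⟨⟨le_rfl, hab⟩, rfl⟩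
  have B2 := hkl (a, d) ⟨rfl, ⟨hcd, le_rfl⟩⟩
  have C1 := hkl (a, c) ⟨rfl, ⟨le_rfl, hcd⟩⟩
  have C2 := hkb (a, c) ⟨⟨le_rfl, hab⟩, rfl⟩
  have D1 := hkb (b, c) ⟨⟨hab, le_rfl⟩, rfl⟩
  have D2 := hkr (b, c) ⟨rfl, ⟨le_rfl, hcd⟩⟩
  rw [abs_lt] at A1 A2 B1 B2 C1 C2 D1 D2
  have hA : |-(Real.pi/2)| < Real.pi := by rw [abs_neg, abs_of_pos] <;> linarith
  have E1 := int_aux (-(Real.pi/2)) (kr - kt) (by push_cast; rw [abs_lt]; constructor <;> nlinarith) hA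
  have E2 := int_aux (-(Real.pi/2)) (kt - kl) (by push_cast; rw [abs_lt]; constructor <;> nlinarith) hA
  have E3 := int_aux (-(Real.pi/2)) (kl - kb) (by push_cast; rw [abs_lt]; constructor <;> nlinarith) hA
  have : kr = kb := by omega
  subst this
  linarith

/-- Brouwer-type lemma. -/
theorem brouwer_zero {r : ℝ} (hr : 0 < r) {Φ : ℝ × ℝ → ℝ × ℝ}
    (hΦ : ContinuousOn Φ (closedBall 0 r)) (h : ∀ v ∈ closedBall (0 : ℝ × ℝ) r, ‖Φ v - v‖ < r) :
    ∃ v ∈ closedBall (0 : ℝ × ℝ) r, Φ v = 0 := by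
  have hball : closedBall (0 : ℝ × ℝ) r = Icc (-r) r ×ˢ Icc (-r) r := by
    rw [show (0 : ℝ × ℝ) = (0, 0) from rfl, ← closedBall_prod_same, Real.closedBall_eq_Icc]
    simp
  rw [hball] at hΦ h ⊢
  have hn : ∀ p ∈ Icc (-r) r ×ˢ Icc (-r) r, |(Φ p).1 - p.1| < r ∧ |(Φ p).2 - p.2| < r := by
    intro p hp
    have := h p hp
    rw [Prod.norm_def, max_lt_iff] at this
    exact this
  obtain ⟨s, hs, t, ht, h1, h2⟩ := miranda (F := fun s t => (Φ (s, t)).1) (G := fun s t => (Φ (s, t)).2)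
    (show -r ≤ r by linarith) (show -r ≤ r by linarith) (continuous_fst.comp_continuousOn hΦ)
    (continuous_snd.comp_continuousOn hΦ)
    (fun t ht => by have := (abs_lt.1 (hn (-r, t) ⟨⟨le_rfl, by linarith⟩, ht⟩).1).2; simp only at *; linarith)
    (fun t ht => by have := (abs_lt.1 (hn (r, t) ⟨⟨by linarith, le_rfl⟩, ht⟩).1).1; simp only at *; linarith)
    (fun t ht => by have := (abs_lt.1 (hn (t, -r) ⟨ht, ⟨le_rfl, by linarith⟩⟩).2).2; simp only at *; linarith)
    (fun t ht => by have := (abs_lt.1 (hn (t, r) ⟨ht, ⟨by linarith, le_rfl⟩⟩).2).1; simp only at *; linarith)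
  exact ⟨(s, t), ⟨hs, ht⟩, Prod.ext h1 h2⟩



section lifts
variable {X V : Type*} [TopologicalSpace X] [T2Space X] [NormedAddCommGroup V] [NormedSpace ℝ V]

lemma sumElim_localHomeo {p : X → V} (hp : IsLocalHomeomorph p) :
    IsLocalHomeomorph (Sum.elim p (id : V → V)) := by
  refine IsLocalHomeomorph.mk _ ?_
  rintro (x | v)
  · obtain ⟨e, hx, he⟩ := hp x
    have : Nonempty X := ⟨x⟩
    refine ⟨(IsOpenEmbedding.inl (X := X) (Y := V)).toOpenPartialHomeomorph.symm.trans e, ?_, ?_⟩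
    · simp only [OpenPartialHomeomorph.trans_source, OpenPartialHomeomorph.symm_source]
      refine ⟨by simp, ?_⟩
      rw [mem_preimage]
      convert! hx
      exact (IsOpenEmbedding.inl (X := X) (Y := V)).toOpenPartialHomeomorph_left_inv
    · rintro y ⟨hy, -⟩
      simp at hy
      obtain ⟨y, rfl⟩ := hy
      simp only [Sum.elim_inl, OpenPartialHomeomorph.coe_trans, comp_apply]
      rw [(IsOpenEmbedding.inl (X := X) (Y := V)).toOpenPartialHomeomorph_left_inv, he]
  · have : Nonempty V := ⟨v⟩
    refine ⟨(IsOpenEmbedding.inr (X := X) (Y := V)).toOpenPartialHomeomorph.symm, by simp, ?_⟩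
    · intro y hy
      simp at hy
      obtain ⟨y, rfl⟩ := hy
      simp only [Sum.elim_inr, id]
      exact (IsOpenEmbedding.inr (X := X) (Y := V)).toOpenPartialHomeomorph_left_inv.symm

def IsRadLift (p : X → V) (x0 : X) (y : V) (Γ : C(unitInterval, X)) : Prop :=
  Γ 0 = x0 ∧ ∀ t, p (Γ t) = p x0 + (t : ℝ) • (y - p x0)

def Om (p : X → V) (x0 : X) : Set V := {y | ∃ Γ, IsRadLift p x0 y Γ}

open Classical in
def gl (p : X → V) (x0 : X) (y : V) : X :=
  if h : ∃ Γ, IsRadLift p x0 y Γ then h.choose 1 else x0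

variable {p : X → V} (hp : IsLocalHomeomorph p) {x0 : X}
include hp

lemma radLift_unique {y : V} {Γ Γ' : C(unitInterval, X)} {x0' : X} (h : IsRadLift p x0 y Γ)
    (h' : IsRadLift p x0' y Γ') (hx : p x0 = p x0') (t : unitInterval) (ht : Γ t = Γ' t) : Γ = Γ' := by
  have := (T2Space.isSeparatedMap p).eq_of_comp_eq hp.isLocallyInjective Γ.continuous Γ'.continuous
    (by ext t; simp [h.2 t, h'.2 t, hx]) t ht
  exact DFunLike.coe_injective this

lemma gl_eq {y : V} {Γ : C(unitInterval, X)} (h : IsRadLift p x0 y Γ) : gl p x0 y = Γ 1 := by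
  have h' : ∃ Γ, IsRadLift p x0 y Γ := ⟨Γ, h⟩
  rw [gl, dif_pos h', radLift_unique hp h'.choose_spec h rfl 0 (h'.choose_spec.1.trans h.1.symm)]

lemma p_gl {y : V} (h : y ∈ Om p x0) : p (gl p x0 y) = y := by
  obtain ⟨Γ, h⟩ := h
  rw [gl_eq hp h, h.2]; simp

lemma gl_unique {x1 x2 : X} (hx : p x1 = p x2) {y : V} (h1 : y ∈ Om p x1) (h2 : y ∈ Om p x2)
    (h : gl p x1 y = gl p x2 y) : x1 = x2 := by
  obtain ⟨Γ, h1⟩ := h1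
  obtain ⟨Γ', h2⟩ := h2
  rw [gl_eq hp h1, gl_eq hp h2] at h
  rw [← h1.1, ← h2.1, radLift_unique hp h1 h2 hx 1 h]

lemma Om_star {y : V} {Γ : C(unitInterval, X)} (h : IsRadLift p x0 y Γ) (t : unitInterval) :
    p x0 + (t : ℝ) • (y - p x0) ∈ Om p x0 ∧ gl p x0 (p x0 + (t : ℝ) • (y - p x0)) = Γ t := by
  have : IsRadLift p x0 (p x0 + (t : ℝ) • (y - p x0)) ⟨fun s => Γ (s * t), by fun_prop⟩ := by
    refine ⟨by simp [h.1], fun s => ?_⟩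
    simp [h.2, mul_smul]
  refine ⟨⟨_, this⟩, ?_⟩
  rw [gl_eq hp this]; simp

lemma Om_star' {y : V} (h : y ∈ Om p x0) {t : ℝ} (ht : t ∈ Icc (0 : ℝ) 1) :
    p x0 + t • (y - p x0) ∈ Om p x0 := by
  obtain ⟨Γ, h⟩ := h
  exact (Om_star hp h ⟨t, ht⟩).1

omit [T2Space X] hp in
lemma const_isRadLift : IsRadLift p x0 (p x0) (ContinuousMap.const _ x0) := by
  refine ⟨rfl, fun t => by simp⟩

omit [T2Space X] hp in
lemma Om_base : p x0 ∈ Om p x0 := ⟨_, const_isRadLift⟩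

lemma gl_base : gl p x0 (p x0) = x0 := by rw [gl_eq hp const_isRadLift]; rfl

lemma Om_section {C : Set V} (hC : ∀ y ∈ C, ∀ t ∈ Icc (0 : ℝ) 1, p x0 + t • (y - p x0) ∈ C)
    {s : V → X} (hs : ContinuousOn s C) (hps : ∀ y ∈ C, p (s y) = y) (h0 : s (p x0) = x0)
    {y : V} (hy : y ∈ C) : y ∈ Om p x0 ∧ gl p x0 y = s y := by
  have : IsRadLift p x0 y ⟨fun t : unitInterval => s (p x0 + (t : ℝ) • (y - p x0)),
      hs.comp_continuous (by fun_prop) (fun t => hC y hy t t.2)⟩ := by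
    refine ⟨by simp [h0], fun t => ?_⟩
    exact hps _ (hC y hy t t.2)
  refine ⟨⟨_, this⟩, ?_⟩
  rw [gl_eq hp this]; simp

lemma Om_nhds {a : V} (ha : a ∈ Om p x0) : ∃ N ∈ 𝓝 a, N ⊆ Om p x0 ∧ ContinuousOn (gl p x0) N := by
  classical
  obtain ⟨Γ, hΓ⟩ := ha
  set F : C(unitInterval × V, V) := ⟨fun q => p x0 + (q.1 : ℝ) • (q.2 - p x0), by fun_prop⟩ with hF
  set g : unitInterval × V → X ⊕ V := fun q => if q.1 = 0 then Sum.inl x0 else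
    if q.2 = a then Sum.inl (Γ q.1) else Sum.inr (F q) with hg
  have hga : ∀ t, g (t, a) = Sum.inl (Γ t) := by
    intro t
    by_cases h : t = 0
    · simp [hg, h, hΓ.1]
    · simp [hg, h]
  obtain ⟨N, hN, g', hc, hl, h0, -⟩ := (sumElim_localHomeo hp).exists_lift_nhds (f := F) (g := g)
    (by
      ext ⟨t, y⟩
      by_cases h : t = 0
      · simp [hg, hF, h]
      · by_cases hy : y = a
        · simp [hg, hF, h, hy, hΓ.2]
        · simp [hg, h, hy])
    (by simp only [hg, if_true]; exact continuous_const) a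
    (by simp only [hga]; exact continuous_inl.comp Γ.continuous)
  set r : X ⊕ V → X := Sum.elim id (fun _ => x0) with hr
  have hrc : Continuous r := continuous_id.sumElim continuous_const
  have hcy : ∀ y ∈ N, Continuous (fun t => g' (t, y)) := fun y hy =>
    hc.comp_continuous (by fun_prop) (fun t => ⟨mem_univ _, hy⟩)
  have hcr : ∀ y, y ∈ N → Continuous (fun t => r (g' (t, y))) := fun y hy => hrc.comp (hcy y hy)
  have hlift : ∀ y (hy : y ∈ N), IsRadLift p x0 y ⟨fun t => r (g' (t, y)), hcr y hy⟩ := by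
    intro y hy
    have h00 : g' (0, y) = Sum.inl x0 := by rw [h0]; simp [hg]
    refine ⟨by simp [h00, hr], fun t => ?_⟩
    have hcl : IsClopen ((fun t => g' (t, y)) ⁻¹' (range Sum.inl)) :=
      isClopen_range_inl.preimage (hcy y hy)
    have huniv := hcl.eq_univ ⟨0, x0, h00.symm⟩
    have ht : t ∈ ((fun t => g' (t, y)) ⁻¹' (range Sum.inl)) := huniv ▸ mem_univ t
    obtain ⟨x, hx⟩ := ht
    have h1 := congrFun hl (t, y)
    simp only [comp_apply] at h1
    simp only at hx
    simp only [ContinuousMap.coe_mk]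
    rw [← hx] at h1 ⊢
    simpa [hr, hF] using h1
  refine ⟨N, hN, fun y hy => ⟨_, hlift y hy⟩, ?_⟩
  have : ContinuousOn (fun y => r (g' (1, y))) N :=
    hrc.comp_continuousOn (hc.comp (by fun_prop) (fun y hy => ⟨mem_univ _, hy⟩))
  refine this.congr fun y hy => ?_
  rw [gl_eq hp (hlift y hy)]; rfl

lemma Om_open : IsOpen (Om p x0) := by
  rw [isOpen_iff_mem_nhds]
  intro a ha
  obtain ⟨N, hN, h, -⟩ := Om_nhds hp ha
  exact mem_of_superset hN h

lemma gl_cont : ContinuousOn (gl p x0) (Om p x0) := by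
  intro a ha
  obtain ⟨N, hN, h, hc⟩ := Om_nhds hp ha
  exact (hc.continuousAt hN).continuousWithinAt

lemma gl_contAt {a : V} (ha : a ∈ Om p x0) : ContinuousAt (gl p x0) a :=
  (gl_cont hp).continuousAt ((Om_open hp).mem_nhds ha)

lemma first_bad {y : V} (hy : y ∉ Om p x0) : ∃ τ ∈ Ioc (0 : ℝ) 1, p x0 + τ • (y - p x0) ∉ Om p x0 ∧
    ∀ t ∈ Ico (0 : ℝ) 1, p x0 + t • ((p x0 + τ • (y - p x0)) - p x0) ∈ Om p x0 := by
  set S : Set ℝ := Icc 0 1 ∩ (fun t : ℝ => p x0 + t • (y - p x0)) ⁻¹' (Om p x0)ᶜ with hS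
  have hcl : IsClosed ((fun t : ℝ => p x0 + t • (y - p x0)) ⁻¹' (Om p x0)ᶜ) :=
    (Om_open hp).isClosed_compl.preimage (by fun_prop)
  have hSc : IsCompact S := isCompact_Icc.inter_right hcl
  have h1 : (1 : ℝ) ∈ S := ⟨by simp, by simpa using hy⟩
  obtain ⟨τ, hτ, hmin⟩ := hSc.exists_isLeast ⟨1, h1⟩
  have hτ0 : τ ≠ 0 := by
    rintro rfl
    exact hτ.2 (by simpa using Om_base)
  have hpos : 0 < τ := lt_of_le_of_ne hτ.1.1 (Ne.symm hτ0)
  refine ⟨τ, ⟨hpos, hτ.1.2⟩, hτ.2, fun t ht => ?_⟩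
  by_contra hcon
  have : t * τ ∈ S := ⟨⟨mul_nonneg ht.1 hpos.le, by nlinarith [ht.2, hτ.1.2, ht.1]⟩, by
    rw [add_sub_cancel_left, smul_smul] at hcon
    exact hcon⟩
  have := hmin this
  nlinarith [ht.2]

lemma no_cluster {b : V} (hb : b ∉ Om p x0)
    (hseg : ∀ t ∈ Ico (0 : ℝ) 1, p x0 + t • (b - p x0) ∈ Om p x0) (z : X) :
    ¬ MapClusterPt z (𝓝[Om p x0] b) (gl p x0) := by
  intro hcl
  have sep := T2Space.isSeparatedMap p
  have inj := hp.isLocallyInjective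
  set y0 := p x0 with hy0
  -- p z = b
  have hpz : p z = b := by
    have h1 : MapClusterPt (p z) (𝓝[Om p x0] b) (p ∘ gl p x0) :=
      hcl.continuousAt_comp hp.continuous.continuousAt
    have h2 : Tendsto (p ∘ gl p x0) (𝓝[Om p x0] b) (𝓝 b) := by
      refine Tendsto.congr' ?_ (tendsto_id.mono_left nhdsWithin_le_nhds)
      filter_upwards [self_mem_nhdsWithin] with y hy
      exact (p_gl hp hy).symm
    by_contra hne
    obtain ⟨u, v, hu, hv, huv⟩ := t2_separation_nhds hne
    have h3 := h1.frequently hu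
    obtain ⟨y, hy1, hy2⟩ := (h3.and_eventually (h2 hv)).exists
    exact Set.disjoint_left.1 huv hy1 hy2
  obtain ⟨e, hze, rfl⟩ := hp z
  have hbt : b ∈ e.target := hpz ▸ e.map_source hze
  obtain ⟨r, hr, hball⟩ := Metric.isOpen_iff.1 e.open_target b hbt
  have hkc : ContinuousOn e.symm (ball b r) := e.continuousOn_symm.mono hball
  have hpk : ∀ y ∈ ball b r, e (e.symm y) = y := fun y hy => e.right_inv (hball hy)
  have hfreq : ∃ᶠ y in 𝓝[Om e x0] b, y ∈ Om e x0 ∧ y ∈ ball b r ∧ gl e x0 y = e.symm y := by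
    have h1 := hcl.frequently (e.open_source.mem_nhds hze)
    have h2 : ∀ᶠ y in 𝓝[Om e x0] b, y ∈ Om e x0 ∧ y ∈ ball b r :=
      Filter.inter_mem self_mem_nhdsWithin (mem_nhdsWithin_of_mem_nhds (ball_mem_nhds b hr))
    refine (h1.and_eventually h2).mono ?_
    rintro y ⟨h3, h4, h5⟩
    refine ⟨h4, h5, ?_⟩
    have := e.left_inv h3
    rw [p_gl hp h4] at this
    exact this.symm
  -- segment lemma
  have hseg' : ∀ y, ∀ t0 ∈ Icc (0:ℝ) 1, (∀ t ∈ Icc t0 1, y0 + t • (y - y0) ∈ Om e x0 ∩ ball b r) →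
      gl e x0 y = e.symm y → gl e x0 (y0 + t0 • (y - y0)) = e.symm (y0 + t0 • (y - y0)) := by
    intro y t0 ht0 hI hy
    set φ : ℝ → V := fun t => y0 + t • (y - y0) with hφ
    have hφc : Continuous φ := by fun_prop
    have := sep.eqOn_of_comp_eqOn inj (isPreconnected_Icc (a := t0) (b := 1)) (g₁ := gl e x0 ∘ φ)
      (g₂ := e.symm ∘ φ) ((gl_cont hp).comp hφc.continuousOn (fun t ht => (hI t ht).1))
      (hkc.comp hφc.continuousOn (fun t ht => (hI t ht).2))
      (fun t ht => by
        simp only [comp_apply]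
        rw [p_gl hp (hI t ht).1, hpk _ (hI t ht).2]) (a := 1) ⟨ht0.2, le_rfl⟩
      (by simp [hφ, hy])
    exact this ⟨le_rfl, ht0.2⟩
  -- choose t0
  obtain ⟨t0, ht0, hct0⟩ : ∃ t0 ∈ Ico (0 : ℝ) 1, ∀ t ∈ Icc t0 1, y0 + t • (b - y0) ∈ ball b r := by
    have hc : ContinuousAt (fun t : ℝ => y0 + t • (b - y0)) 1 := by fun_prop
    have : ∀ᶠ t in 𝓝 (1 : ℝ), y0 + t • (b - y0) ∈ ball b r :=
      hc (by simpa using ball_mem_nhds b hr)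
    obtain ⟨δ, hδ, h⟩ := Metric.eventually_nhds_iff.1 this
    refine ⟨max 0 (1 - δ / 2), ⟨le_max_left _ _, max_lt one_pos (by linarith)⟩, fun t ht => h ?_⟩
    rw [Real.dist_eq, abs_lt]
    have := (le_max_right _ _).trans ht.1
    constructor <;> linarith [ht.2]
  have hconv : ∀ y ∈ ball b r, ∀ t ∈ Icc t0 1, y0 + t0 • (y - y0) ∈ ball b r →
      y0 + t • (y - y0) ∈ ball b r := by
    intro y hy t ht h
    have hcv := (convex_ball b r) h hy (a := (1 - t) / (1 - t0)) (b := (t - t0) / (1 - t0))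
      (div_nonneg (by linarith [ht.2]) (by linarith [ht0.2]))
      (div_nonneg (by linarith [ht.1]) (by linarith [ht0.2]))
      (by rw [← add_div, div_eq_one_iff_eq] <;> linarith [ht0.2])
    convert! hcv using 1
    have hne : 1 - t0 ≠ 0 := by linarith [ht0.2]
    match_scalars <;> field_simp <;> ring
  set c := y0 + t0 • (b - y0) with hc
  have hcO : c ∈ Om e x0 := hseg t0 ht0
  have hcB : c ∈ ball b r := hct0 t0 ⟨le_rfl, ht0.2.le⟩
  have hgc : gl e x0 c = e.symm c := by
    by_contra hne
    obtain ⟨u, v, hu, hv, huv⟩ := t2_separation_nhds hne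
    have hψ : Tendsto (fun y => y0 + t0 • (y - y0)) (𝓝[Om e x0] b) (𝓝 c) := by
      have : ContinuousAt (fun y => y0 + t0 • (y - y0)) b := by fun_prop
      exact this.tendsto.mono_left nhdsWithin_le_nhds
    have h1 := ((gl_contAt hp hcO).tendsto.comp hψ) hu
    have h2 := ((hkc.continuousAt (isOpen_ball.mem_nhds hcB)).tendsto.comp hψ) hv
    have h3 := hψ (isOpen_ball.mem_nhds hcB)
    obtain ⟨y, ⟨hy1, hy2, hy3⟩, ⟨hy4, hy5⟩, hy6⟩ :=
      (hfreq.and_eventually (Filter.inter_mem (Filter.inter_mem h1 h2) h3)).exists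
    have := hseg' y t0 ⟨ht0.1, ht0.2.le⟩
      (fun t ht => ⟨Om_star' hp hy1 ⟨ht0.1.trans ht.1, ht.2⟩, hconv y hy2 t ht hy6⟩) hy3
    simp only [mem_preimage, comp_apply] at hy4 hy5
    rw [this] at hy4
    exact Set.disjoint_left.1 huv hy4 hy5
  -- agreement on [c,b)
  set φ : ℝ → V := fun t => y0 + t • (b - y0) with hφ
  have hφc : Continuous φ := by fun_prop
  have hag : EqOn (gl e x0 ∘ φ) (e.symm ∘ φ) (Ico t0 1) :=
    sep.eqOn_of_comp_eqOn inj (isPreconnected_Ico (a := t0) (b := 1))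
      ((gl_cont hp).comp hφc.continuousOn (fun t ht => hseg t ⟨ht0.1.trans ht.1, ht.2⟩))
      (hkc.comp hφc.continuousOn (fun t ht => hct0 t ⟨ht.1, ht.2.le⟩))
      (fun t ht => by
        simp only [comp_apply]
        rw [p_gl hp (hseg t ⟨ht0.1.trans ht.1, ht.2⟩), hpk _ (hct0 t ⟨ht.1, ht.2.le⟩)]) (a := t0) ⟨le_rfl, ht0.2⟩ hgc
  -- build the lift
  apply hb
  have hGc : ContinuousOn (fun t : ℝ => if t ≤ t0 then gl e x0 (φ t) else e.symm (φ t)) (Icc 0 1) := by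
    refine ContinuousOn.if ?_ ?_ ?_
    · rintro t ⟨-, ht⟩
      have : t = t0 := by
        have := frontier_le_subset_eq continuous_id continuous_const ht
        simpa using this
      rw [this]; exact hgc
    · refine (gl_cont hp).comp hφc.continuousOn ?_
      rintro t ⟨h1, h2⟩
      have h3 : t ≤ t0 := by
        have : closure {a : ℝ | a ≤ t0} = Iic t0 := isClosed_Iic.closure_eq
        rw [this] at h2; exact h2
      exact hseg t ⟨h1.1, h3.trans_lt ht0.2⟩
    · refine hkc.comp hφc.continuousOn ?_
      rintro t ⟨h1, h2⟩
      have h3 : t0 ≤ t := by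
        have h4 : {a : ℝ | ¬ a ≤ t0} = Ioi t0 := by ext; simp
        rw [h4, closure_Ioi] at h2; exact h2
      exact hct0 t ⟨h3, h1.2⟩
  refine ⟨⟨fun t : unitInterval => if (t : ℝ) ≤ t0 then gl e x0 (φ t) else e.symm (φ t), ?_⟩, ?_, ?_⟩
  · exact hGc.comp_continuous continuous_subtype_val (fun t => t.2)
  · simp [ht0.1, hφ, hy0, gl_base hp]
  · intro t
    simp only [ContinuousMap.coe_mk]
    split_ifs with h
    · rw [p_gl hp (hseg t ⟨t.2.1, h.trans_lt ht0.2⟩)]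
    · rw [hpk _ (hct0 t ⟨(not_le.1 h).le, t.2.2⟩)]
end lifts



lemma exists_equiv (L : ℝ × ℝ →L[ℝ] ℝ × ℝ) (h : ∀ v, L v = 0 → v = 0) :
    ∃ e : (ℝ × ℝ) ≃L[ℝ] (ℝ × ℝ), ∀ v, e v = L v := by
  have hinj : Injective L.toLinearMap := (injective_iff_map_eq_zero L).2 h
  exact ⟨(LinearEquiv.ofInjectiveEndo L.toLinearMap hinj).toContinuousLinearEquiv, fun v => rfl⟩

lemma fderiv_ball {f : ℝ × ℝ → ℝ × ℝ} {L : ℝ × ℝ →L[ℝ] ℝ × ℝ} {p : ℝ × ℝ} (hf : HasFDerivAt f L p)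
    {c : ℝ} (hc : 0 < c) : ∃ δ > 0, ∀ x, ‖x - p‖ < δ → ‖f x - f p - L (x - p)‖ ≤ c * ‖x - p‖ := by
  have := hf.isLittleO.def hc
  obtain ⟨δ, hδ, h⟩ := Metric.eventually_nhds_iff.1 this
  exact ⟨δ, hδ, fun x hx => h (by rwa [dist_eq_norm])⟩

lemma solve {f : ℝ × ℝ → ℝ × ℝ} {L : ℝ × ℝ →L[ℝ] ℝ × ℝ} {p : ℝ × ℝ} (hf : HasFDerivAt f L p)
    (h : ∀ v, L v = 0 → v = 0) {r : ℝ} (hr : 0 < r) : ∃ ρ > 0, ∃ r' > 0, r' ≤ r ∧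
      ∀ G : ℝ × ℝ → ℝ × ℝ, ContinuousOn G (closedBall p r') →
      (∀ x ∈ closedBall p r', ‖G x - f x‖ ≤ ρ) → ∃ x ∈ closedBall p r', G x = f p := by
  obtain ⟨e, he⟩ := exists_equiv L h
  set M : ℝ × ℝ →L[ℝ] ℝ × ℝ := e.symm.toContinuousLinearMap with hM
  set K := ‖M‖ + 1 with hK
  have hKpos : 0 < K := by positivity
  obtain ⟨δ, hδ, hd⟩ := fderiv_ball hf (c := 1 / (4 * K)) (by positivity)
  set r' := min r (δ / 2) with hr'
  have hr'pos : 0 < r' := lt_min hr (by linarith)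
  refine ⟨r' / (4 * K), by positivity, r', hr'pos, min_le_left _ _, fun G hG hGf => ?_⟩
  have hmem : ∀ v ∈ closedBall (0 : ℝ × ℝ) r', p + v ∈ closedBall p r' := by
    intro v hv; simpa [dist_eq_norm] using hv
  obtain ⟨v, hv, hv0⟩ := brouwer_zero hr'pos (Φ := fun v => M (G (p + v) - f p))
    (M.continuous.comp_continuousOn (by
      refine ContinuousOn.sub (hG.comp (by fun_prop) hmem) continuousOn_const)) (by
    intro v hv
    have h1 : M (G (p + v) - f p) - v = M ((G (p + v) - f (p + v)) + (f (p + v) - f p - L (p + v - p))) := by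
      have : M (L v) = v := by rw [← he v]; simp [hM]
      simp only [map_add, map_sub, add_sub_cancel_left, this]
      abel
    rw [h1]
    have h2 := hGf _ (hmem v hv)
    have hvn : ‖v‖ ≤ r' := by simpa using hv
    have h3 := hd (p + v) (by
      rw [add_sub_cancel_left]
      have : r' ≤ δ / 2 := min_le_right _ _
      linarith)
    rw [add_sub_cancel_left] at h3
    rw [add_sub_cancel_left]
    calc _ ≤ ‖M‖ * ‖(G (p + v) - f (p + v)) + (f (p + v) - f p - L v)‖ := M.le_opNorm _
      _ ≤ ‖M‖ * (r' / (4 * K) + 1 / (4 * K) * r') := by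
        gcongr
        refine (norm_add_le _ _).trans (add_le_add h2 (h3.trans (by gcongr)))
      _ ≤ K * (r' / (4 * K) + 1 / (4 * K) * r') := by gcongr; linarith
      _ = r' / 2 := by field_simp; norm_num
      _ < r' := by linarith)
  refine ⟨p + v, hmem v hv, ?_⟩
  have : G (p + v) - f p = 0 := by
    have := congrArg e hv0
    simpa [hM] using this
  exact sub_eq_zero.1 this

lemma open_of_fderiv {f : ℝ × ℝ → ℝ × ℝ} {f' : ℝ × ℝ → ℝ × ℝ →L[ℝ] ℝ × ℝ}
    (hf : ∀ p, HasFDerivAt f (f' p) p) (h : ∀ p v, f' p v = 0 → v = 0) : IsOpenMap f := by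
  have hc : Continuous f := continuous_iff_continuousAt.2 fun p => (hf p).continuousAt
  rw [IsOpenMap]
  intro U hU
  rw [isOpen_iff_mem_nhds]
  rintro _ ⟨p, hp, rfl⟩
  obtain ⟨r, hr, hball⟩ := Metric.isOpen_iff.1 hU p hp
  obtain ⟨ρ, hρ, r', hr', hrr, H⟩ := solve (hf p) (h p) (r := r / 2) (by linarith)
  refine mem_of_superset (ball_mem_nhds _ hρ) fun z hz => ?_
  obtain ⟨x, hx, hx2⟩ := H (fun x => f x + (f p - z)) (by fun_prop) (by
    intro x _
    simp only [add_sub_cancel_left]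
    rw [← dist_eq_norm, dist_comm]
    exact (mem_ball.1 hz).le)
  refine ⟨x, hball ?_, ?_⟩
  · rw [mem_ball]; rw [mem_closedBall] at hx; linarith
  · have : f x - z = 0 := by
      have := sub_eq_zero.2 hx2
      rw [← this]; abel
    exact sub_eq_zero.1 this

lemma localHomeo_of {X Y : Type*} [TopologicalSpace X] [TopologicalSpace Y] {p : X → Y} (hc : Continuous p)
    (ho : IsOpenMap p) (hi : ∀ x, ∃ U ∈ 𝓝 x, InjOn p U) : IsLocalHomeomorph p := by
  rw [isLocalHomeomorph_iff_isOpenEmbedding_restrict]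
  intro x
  obtain ⟨U, hU, hinj⟩ := hi x
  refine ⟨interior U, interior_mem_nhds.2 hU, ?_⟩
  refine .of_continuous_injective_isOpenMap (hc.comp continuous_subtype_val) ?_
    (ho.domRestrict isOpen_interior)
  exact (hinj.mono interior_subset).injective

lemma Om_closure {X V : Type*} [TopologicalSpace X] [NormedAddCommGroup V] [NormedSpace ℝ V]
    {p : X → V} {x0 : X} {b : V}
    (hseg : ∀ t ∈ Ico (0 : ℝ) 1, p x0 + t • (b - p x0) ∈ Om p x0) : (𝓝[Om p x0] b).NeBot := by
  rw [← mem_closure_iff_nhdsWithin_neBot]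
  have hc : Continuous (fun t : ℝ => p x0 + t • (b - p x0)) := by fun_prop
  have h1 : (1 : ℝ) ∈ closure (Ico (0 : ℝ) 1) := by rw [closure_Ico (by norm_num)]; simp
  have := map_mem_closure hc h1 (fun t ht => hseg t ht)
  simpa using this

lemma cluster_eq {X V : Type*} [TopologicalSpace X] [T2Space X] [NormedAddCommGroup V] [NormedSpace ℝ V]
    {p : X → V} (hp : IsLocalHomeomorph p) {x0 : X} {Y : Type*} [TopologicalSpace Y] {i : X → Y}
    {f : Y → V} (hf : Continuous f) (hfi : ∀ x, f (i x) = p x)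
    {b : V} {z : Y} (hcl : MapClusterPt z (𝓝[Om p x0] b) (i ∘ gl p x0)) : f z = b := by
  have h1 : MapClusterPt (f z) (𝓝[Om p x0] b) (f ∘ i ∘ gl p x0) :=
    hcl.continuousAt_comp hf.continuousAt
  have h2 : Tendsto (f ∘ i ∘ gl p x0) (𝓝[Om p x0] b) (𝓝 b) := by
    refine Tendsto.congr' ?_ (tendsto_id.mono_left nhdsWithin_le_nhds)
    filter_upwards [self_mem_nhdsWithin] with y hy
    simp only [comp_apply, hfi, id]
    exact (p_gl hp hy).symm
  by_contra hne
  obtain ⟨u, v, hu, hv, huv⟩ := t2_separation_nhds hne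
  have h3 := h1.frequently hu
  obtain ⟨y, hy1, hy2⟩ := (h3.and_eventually (h2 hv)).exists
  exact Set.disjoint_left.1 huv hy1 hy2

def FF (f : ℝ × ℝ → ℝ × ℝ) (n : ℕ) : Set (ℝ × ℝ) :=
  {p | ∀ x, ‖x - p‖ < 1 / (n + 1 : ℝ) → ‖x - p‖ ≤ (n + 1) * ‖f x - f p‖}

lemma FF_closed {f : ℝ × ℝ → ℝ × ℝ} (hc : Continuous f) (n : ℕ) : IsClosed (FF f n) := by
  have : FF f n = ⋂ x, ({p | 1 / (n + 1 : ℝ) ≤ ‖x - p‖} ∪ {p | ‖x - p‖ ≤ (n + 1) * ‖f x - f p‖}) := by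
    ext p
    simp only [FF, mem_ofPred_eq, mem_iInter, mem_union]
    refine forall_congr' fun x => ?_
    rw [imp_iff_not_or, not_lt]
  rw [this]
  refine isClosed_iInter fun x => (isClosed_le (by fun_prop) (by fun_prop)).union
    (isClosed_le (by fun_prop) (by fun_prop))

lemma FF_cover {f : ℝ × ℝ → ℝ × ℝ} {L : ℝ × ℝ →L[ℝ] ℝ × ℝ} {p : ℝ × ℝ} (hf : HasFDerivAt f L p)
    (h : ∀ v, L v = 0 → v = 0) : ∃ n, p ∈ FF f n := by
  obtain ⟨e, he⟩ := exists_equiv L h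
  set M : ℝ × ℝ →L[ℝ] ℝ × ℝ := e.symm.toContinuousLinearMap with hM
  set K := ‖M‖ + 1 with hK
  have hKpos : 0 < K := by positivity
  obtain ⟨δ, hδ, hd⟩ := fderiv_ball hf (c := 1 / (2 * K)) (by positivity)
  obtain ⟨n, hn⟩ := exists_nat_gt (max (1 / δ) (2 * K))
  have hn1 : 1 / δ < n + 1 := by linarith [le_max_left (1 / δ) (2 * K)]
  have hn2 : 2 * K < n + 1 := by linarith [le_max_right (1 / δ) (2 * K)]
  refine ⟨n, fun x hx => ?_⟩
  have h1 : ‖x - p‖ < δ := by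
    refine hx.trans ?_
    rw [div_lt_comm₀ (by positivity) hδ]
    exact hn1
  have h2 := hd x h1
  have h3 : ‖x - p‖ ≤ K * ‖L (x - p)‖ := by
    have : M (L (x - p)) = x - p := by rw [← he (x - p)]; simp [hM]
    calc ‖x - p‖ = ‖M (L (x - p))‖ := by rw [this]
      _ ≤ ‖M‖ * ‖L (x - p)‖ := M.le_opNorm _
      _ ≤ K * ‖L (x - p)‖ := by gcongr; linarith
  have h4 : ‖L (x - p)‖ ≤ ‖f x - f p‖ + 1 / (2 * K) * ‖x - p‖ := by
    have : L (x - p) = (f x - f p) - (f x - f p - L (x - p)) := by abel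
    rw [this]
    refine (norm_sub_le _ _).trans ?_
    gcongr
  have h5 : ‖x - p‖ ≤ K * ‖f x - f p‖ + ‖x - p‖ / 2 := by
    calc _ ≤ K * (‖f x - f p‖ + 1 / (2 * K) * ‖x - p‖) := h3.trans (by gcongr)
      _ = _ := by field_simp
  nlinarith [norm_nonneg (f x - f p)]

theorem loc_inj {f : ℝ × ℝ → ℝ × ℝ} {f' : ℝ × ℝ → ℝ × ℝ →L[ℝ] ℝ × ℝ}
    (hf : ∀ p, HasFDerivAt f (f' p) p) (h : ∀ p v, f' p v = 0 → v = 0) :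
    ∀ x, ∃ U ∈ 𝓝 x, InjOn f U := by
  have hc : Continuous f := continuous_iff_continuousAt.2 fun p => (hf p).continuousAt
  have hopen := open_of_fderiv hf h
  set O : Set (ℝ × ℝ) := {x | ∃ U ∈ 𝓝 x, InjOn f U} with hO
  have hOo : IsOpen O := by
    rw [isOpen_iff_mem_nhds]
    rintro x ⟨U, hU, hi⟩
    filter_upwards [eventually_mem_nhds_iff.2 hU] with y hy
    exact ⟨U, hy, hi⟩
  suffices hS : Oᶜ = ∅ by
    intro x
    have : x ∈ O := by rw [compl_empty_iff.1 hS]; trivial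
    exact this
  by_contra hne
  have hne : (Oᶜ).Nonempty := nonempty_iff_ne_empty.2 hne
  set S := Oᶜ with hS
  have hScl : IsClosed S := hOo.isClosed_compl
  have : Nonempty S := hne.to_subtype
  have : CompleteSpace S := hScl.completeSpace_coe
  obtain ⟨n, hn⟩ := nonempty_interior_of_iUnion_of_closed (X := S)
    (f := fun n : ℕ => (Subtype.val ⁻¹' FF f n : Set S))
    (fun n => (FF_closed hc n).preimage continuous_subtype_val) (by
      ext x
      simp only [mem_iUnion, mem_univ, iff_true]
      exact FF_cover (hf x) (h x))
  obtain ⟨⟨s, hsS⟩, hs⟩ := hn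
  rw [mem_interior_iff_mem_nhds, mem_nhds_subtype] at hs
  obtain ⟨U, hU, hUF⟩ := hs
  obtain ⟨r0, hr0, hball⟩ := Metric.mem_nhds_iff.1 hU
  set N : ℝ := n + 1 with hN
  have hNpos : 0 < N := by positivity
  set r := min (r0 / 2) (1 / (4 * N)) with hr
  have hrpos : 0 < r := lt_min (by linarith) (by positivity)
  have hr1 : r < r0 := by have := min_le_left (r0 / 2) (1 / (4 * N)); linarith
  have hr2 : 2 * r < 1 / N := by
    have h1 := min_le_right (r0 / 2) (1 / (4 * N))
    have h2 : 1 / (4 * N) = (1 / N) / 4 := by field_simp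
    have h3 : 0 < 1 / N := by positivity
    linarith
  have hSF : ∀ e ∈ S, e ∈ closedBall s r → ∀ x, ‖x - e‖ < 1 / N → ‖x - e‖ ≤ N * ‖f x - f e‖ := by
    intro e he heB
    have : (⟨e, he⟩ : S) ∈ (Subtype.val ⁻¹' FF f n : Set S) :=
      hUF (hball ((mem_closedBall.1 heB).trans_lt hr1))
    exact this
  have hdist : ∀ x ∈ closedBall s r, ∀ e ∈ closedBall s r, ‖x - e‖ < 1 / N := by
    intro x hx e he
    rw [← dist_eq_norm]
    have := dist_triangle_right x e s
    rw [mem_closedBall] at hx he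
    linarith
  have hss : s ∈ closedBall s r := mem_closedBall_self hrpos.le
  apply hsS
  obtain ⟨δ, hδ, hfδ⟩ := Metric.continuous_iff.1 hc s (r / (2 * N)) (by positivity)
  refine ⟨ball s (min δ r), ball_mem_nhds _ (lt_min hδ hrpos), ?_⟩
  intro x1 hx1 x2 hx2 h12
  by_contra hx12
  have hb : ∀ x ∈ ball s (min δ r), x ∈ ball s r ∧ ‖f x - f s‖ < r / (2 * N) := fun x hx =>
    ⟨ball_subset_ball (min_le_right _ _) hx, by
      rw [← dist_eq_norm]; exact hfδ x (ball_subset_ball (min_le_left _ _) hx)⟩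
  have hcb := ball_subset_closedBall (x := s) (ε := r)
  -- both are in O
  have hnS : ∀ x ∈ ball s r, ∀ e ∈ S, e ∈ closedBall s r → f x = f e → x = e := by
    intro x hx e he heB hxe
    have := hSF e he heB x (hdist x (hcb hx) e heB)
    rw [hxe, sub_self, norm_zero, mul_zero] at this
    exact sub_eq_zero.1 (norm_le_zero_iff.1 this)
  have hx1O : x1 ∉ S := fun hx => hx12 (hnS x2 (hb x2 hx2).1 x1 hx (hcb (hb x1 hx1).1) h12.symm).symm
  have hx2O : x2 ∉ S := fun hx => hx12 (hnS x1 (hb x1 hx1).1 x2 hx (hcb (hb x2 hx2).1) h12)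
  set w := f x1 with hw
  set K := f '' (S ∩ closedBall s r) with hK
  have hKc : IsCompact K := ((isCompact_closedBall s r).inter_left hScl).image hc
  have hKs : f s ∈ K := ⟨s, ⟨hsS, hss⟩, rfl⟩
  have hwK : w ∉ K := by
    rintro ⟨e, ⟨he, heB⟩, hew⟩
    exact hx1O (hnS x1 (hb x1 hx1).1 e he heB hew.symm ▸ he)
  obtain ⟨e', ⟨e, ⟨heS, heB⟩, rfl⟩, hmin⟩ := hKc.exists_isMinOn ⟨_, hKs⟩
    (f := fun y => ‖y - w‖) (by fun_prop)
  set ρ := ‖f e - w‖ with hρ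
  have hρpos : 0 < ρ := norm_pos_iff.2 (sub_ne_zero.2 fun hh => hwK ⟨e, ⟨heS, heB⟩, hh⟩)
  have hρs : ρ ≤ ‖f s - w‖ := hmin hKs
  have hρK : ∀ y ∈ K, ρ ≤ ‖y - w‖ := fun y hy => hmin hy
  -- the local homeo
  set D : Set (ℝ × ℝ) := O ∩ ball s r with hD
  have hDo : IsOpen D := hOo.inter isOpen_ball
  set p : D → ℝ × ℝ := fun x => f x with hp
  have hpl : IsLocalHomeomorph p := by
    refine localHomeo_of (hc.comp continuous_subtype_val) (hopen.comp hDo.isOpenMap_subtype_val) ?_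
    rintro ⟨x, hx⟩
    obtain ⟨U, hU, hi⟩ := hx.1
    refine ⟨Subtype.val ⁻¹' U, continuous_subtype_val.continuousAt hU, ?_⟩
    intro a ha b hb hab
    exact Subtype.ext (hi ha hb hab)
  have hOm : ∀ x : D, f x = w → ball w ρ ⊆ Om p x := by
    intro x hx y hy
    by_contra hyO
    obtain ⟨τ, hτ, hbO, hseg⟩ := first_bad hpl hyO
    have hpx : p x = w := hx
    set b := p x + τ • (y - p x) with hbdef
    have hbw : ‖b - w‖ < ρ := by
      rw [hbdef, hpx, add_sub_cancel_left, norm_smul, Real.norm_eq_abs, abs_of_pos hτ.1]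
      rw [mem_ball, dist_eq_norm] at hy
      calc _ ≤ 1 * ‖y - w‖ := by gcongr; exact hτ.2
        _ < ρ := by rwa [one_mul]
    have := Om_closure hseg
    obtain ⟨z, hz, hzc⟩ := (isCompact_closedBall s r).exists_mapClusterPt (f := 𝓝[Om p x] b)
      (u := Subtype.val ∘ gl p x) (by
        rw [le_principal_iff]
        exact Filter.mem_map.2 (Filter.Eventually.of_forall fun y => hcb (gl p x y).2.2))
    have hfz : f z = b := cluster_eq hpl hc (fun x => rfl) hzc
    have hzS : z ∉ S := fun hzS => by
      have := hρK b ⟨z, ⟨hzS, hz⟩, hfz⟩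
      linarith
    have hzb : z ∈ ball s r := by
      rw [mem_ball, dist_eq_norm]
      have h1 := hSF s hsS hss z (hdist z hz s hss)
      have h2 : ‖f z - f s‖ < r / N := by
        have h3 := (hb x1 hx1).2
        have h4 : f z - f s = (b - w) + (w - f s) := by rw [hfz]; abel
        rw [h4]
        refine (norm_add_le _ _).trans_lt ?_
        rw [norm_sub_rev] at hρs
        have h5 : r / (2 * N) = (r / N) / 2 := by field_simp
        linarith
      calc _ ≤ _ := h1
        _ < N * (r / N) := by gcongr
        _ = r := by field_simp
    have hzD : z ∈ D := ⟨not_not.1 hzS, hzb⟩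
    refine no_cluster hpl hbO hseg ⟨z, hzD⟩ ?_
    rw [mapClusterPt_iff_frequently] at hzc ⊢
    intro u hu
    rw [mem_nhds_subtype] at hu
    obtain ⟨u', hu', huu⟩ := hu
    exact (hzc u' hu').mono fun y hy => huu hy
  -- the derivative at e
  obtain ⟨L, hL⟩ := exists_equiv (f' e) (h e)
  obtain ⟨δ', hδ', hd⟩ := fderiv_ball (hf e) (c := 1 / (8 * N)) (by positivity)
  obtain ⟨t, ht0, ht1, htδ⟩ : ∃ t : ℝ, 0 < t ∧ t ≤ 1 ∧ 2 * N * t * ρ < δ' := by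
    refine ⟨min 1 (δ' / (4 * N * ρ)), by positivity, min_le_left _ _, ?_⟩
    calc _ ≤ 2 * N * (δ' / (4 * N * ρ)) * ρ := by gcongr; exact min_le_right _ _
      _ = δ' / 2 := by field_simp; norm_num
      _ < δ' := by linarith
  set yt := f e + t • (w - f e) with hyt
  have hwe : ‖w - f e‖ = ρ := by rw [hρ, norm_sub_rev]
  set xs := e + L.symm (yt - f e) with hxs
  have main : ∀ x : D, f x = w → ∃ y ∈ Om p x, (gl p x y).1 = xs := by
    intro x hx
    have hin : ∀ v ∈ closedBall (0 : ℝ × ℝ) (t * ρ / 2), yt + v ∈ Om p x := by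
      intro v hv
      apply hOm x hx
      rw [mem_ball, dist_eq_norm]
      have h1 : yt + v - w = v + (1 - t) • (f e - w) := by rw [hyt]; module
      rw [h1]
      refine (norm_add_le _ _).trans_lt ?_
      rw [norm_smul, Real.norm_eq_abs, abs_of_nonneg (by linarith)]
      have h2 : ‖v‖ ≤ t * ρ / 2 := by simpa using hv
      rw [← hρ]
      nlinarith
    obtain ⟨v, hv, hv0⟩ := brouwer_zero (r := t * ρ / 2) (by positivity)
      (Φ := fun v => L ((gl p x (yt + v)).1 - xs)) (by
        refine L.continuous.comp_continuousOn (ContinuousOn.sub ?_ continuousOn_const)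
        refine continuous_subtype_val.comp_continuousOn ((gl_cont hpl).comp (by fun_prop) hin)) (by
      intro v hv
      have hvn : ‖v‖ ≤ t * ρ / 2 := by simpa using hv
      set x' := gl p x (yt + v) with hx'
      have hfx : f x' = yt + v := p_gl hpl (hin v hv)
      have h1 : L ((x' : ℝ × ℝ) - xs) - v = -(f x' - f e - f' e (x' - e)) := by
        rw [← hL, hfx, hxs]
        have : (x' : ℝ × ℝ) - (e + L.symm (yt - f e)) = (x' - e) - L.symm (yt - f e) := by abel
        rw [this, map_sub L, L.apply_symm_apply]
        abel
      rw [h1, norm_neg]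
      have h2 : ‖(x' : ℝ × ℝ) - e‖ ≤ 2 * N * t * ρ := by
        have h3 := hSF e heS heB x' (hdist x' (hcb x'.2.2) e heB)
        have h4 : ‖f x' - f e‖ ≤ 2 * (t * ρ) := by
          rw [hfx, hyt]
          have : f e + t • (w - f e) + v - f e = t • (w - f e) + v := by abel
          rw [this]
          refine (norm_add_le _ _).trans ?_
          rw [norm_smul, Real.norm_eq_abs, abs_of_pos ht0, hwe]
          nlinarith [mul_pos ht0 hρpos]
        calc _ ≤ _ := h3
          _ ≤ N * (2 * (t * ρ)) := by gcongr
          _ = _ := by ring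
      calc _ ≤ _ := hd x' (h2.trans_lt htδ)
        _ ≤ 1 / (8 * N) * (2 * N * t * ρ) := by gcongr
        _ = t * ρ / 4 := by field_simp; norm_num
        _ < t * ρ / 2 := by nlinarith [mul_pos ht0 hρpos])
    refine ⟨yt + v, hin v hv, ?_⟩
    have : (gl p x (yt + v)).1 - xs = 0 := by
      exact L.map_eq_zero_iff.1 hv0
    exact sub_eq_zero.1 this
  set X1 : D := ⟨x1, not_not.1 hx1O, (hb x1 hx1).1⟩ with hX1
  set X2 : D := ⟨x2, not_not.1 hx2O, (hb x2 hx2).1⟩ with hX2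
  obtain ⟨y1, hy1, hg1⟩ := main X1 rfl
  obtain ⟨y2, hy2, hg2⟩ := main X2 h12.symm
  have hy12 : y1 = y2 := by
    have e1 : f (gl p X1 y1).1 = y1 := p_gl hpl hy1
    have e2 : f (gl p X2 y2).1 = y2 := p_gl hpl hy2
    rw [← e1, ← e2, hg1, hg2]
  subst hy12
  have := gl_unique hpl (x1 := X1) (x2 := X2) h12 hy1 hy2 (Subtype.ext (hg1.trans hg2.symm))
  exact hx12 (congrArg Subtype.val this)

theorem isLocHomeo {f : ℝ × ℝ → ℝ × ℝ} {f' : ℝ × ℝ → ℝ × ℝ →L[ℝ] ℝ × ℝ}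
    (hf : ∀ p, HasFDerivAt f (f' p) p) (h : ∀ p v, f' p v = 0 → v = 0) : IsLocalHomeomorph f :=
  localHomeo_of (continuous_iff_continuousAt.2 fun p => (hf p).continuousAt) (open_of_fderiv hf h)
    (loc_inj hf h)



theorem inj_of_convex {X V : Type*} [TopologicalSpace X] [T2Space X] [NormedAddCommGroup V]
    [NormedSpace ℝ V] [PreconnectedSpace X] {p : X → V} (hp : IsLocalHomeomorph p)
    (hconv : ∀ x0, Convex ℝ (Om p x0)) : Injective p := by
  have hG : ∀ x0 z, p z ∈ Om p x0 ∧ gl p x0 (p z) = z := by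
    intro x0
    set G : Set X := {z | p z ∈ Om p x0 ∧ gl p x0 (p z) = z} with hGdef
    have ho : IsOpen G := by
      rw [isOpen_iff_mem_nhds]
      rintro z ⟨hz1, hz2⟩
      obtain ⟨U, hU, hzU, hinj⟩ := hp.isLocallyInjective z
      have h1 : ∀ᶠ x in 𝓝 z, p x ∈ Om p x0 := hp.continuous.continuousAt ((Om_open hp).mem_nhds hz1)
      have hc : ContinuousAt (fun x => gl p x0 (p x)) z :=
        ContinuousAt.comp (f := p) (gl_contAt hp hz1) hp.continuous.continuousAt
      have h2 : ∀ᶠ x in 𝓝 z, gl p x0 (p x) ∈ U := hc (by simp only [hz2]; exact hU.mem_nhds hzU)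
      filter_upwards [h1, h2, hU.mem_nhds hzU] with x hx1 hx2 hx3
      exact ⟨hx1, hinj hx2 hx3 (p_gl hp hx1)⟩
    have hcl : IsClosed G := by
      rw [← closure_subset_iff_isClosed]
      intro z hz
      obtain ⟨e, hze, rfl⟩ := hp z
      set w := e z with hw
      obtain ⟨r, hr, hball⟩ := Metric.isOpen_iff.1 e.open_target w (e.map_source hze)
      obtain ⟨z', ⟨hz's, hz'b⟩, hz'1, hz'2⟩ := mem_closure_iff_nhds.1 hz (e.source ∩ e ⁻¹' ball w r)
        (Filter.inter_mem (e.open_source.mem_nhds hze) (hp.continuous.continuousAt (ball_mem_nhds _ hr)))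
      obtain ⟨Γ, hΓ⟩ := hz'1
      have hΓ1 : Γ 1 = z' := by rw [← gl_eq hp hΓ]; exact hz'2
      -- z's ball
      obtain ⟨hwO, hwg⟩ := Om_section hp (x0 := z') (C := ball w r) (fun y hy t ht => by
          have := (convex_ball w r).add_smul_sub_mem hz'b hy ht
          exact this) (s := e.symm) (e.continuousOn_symm.mono hball)
        (fun y hy => e.right_inv (hball hy)) (e.left_inv hz's) (mem_ball_self hr)
      rw [hw, e.left_inv hze, ← hw] at hwg
      have hrev : IsRadLift e z' (e x0) ⟨fun t => Γ (unitInterval.symm t), by fun_prop⟩ := by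
        refine ⟨by simp [hΓ1], fun t => ?_⟩
        simp only [ContinuousMap.coe_mk, hΓ.2, unitInterval.coe_symm_eq]
        module
      have h0O : e x0 ∈ Om e z' := ⟨_, hrev⟩
      have h0g : gl e z' (e x0) = x0 := by rw [gl_eq hp hrev]; simp [hΓ.1]
      have := Om_section hp (x0 := x0) (C := Om e z') (fun y hy t ht =>
          (hconv z').add_smul_sub_mem h0O hy ht) (gl_cont hp) (fun y hy => p_gl hp hy) h0g hwO
      exact ⟨this.1, by rw [this.2, hwg]⟩
    have : G = univ := IsClopen.eq_univ ⟨hcl, ho⟩ ⟨x0, Om_base, gl_base hp⟩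
    intro z
    have hz : z ∈ G := this ▸ mem_univ z
    exact hz
  intro x1 x2 h
  have := (hG x1 x2).2
  rw [← h, gl_base hp] at this
  exact this

/-- crossing lemma -/
def ell (m : ℝ) : ℝ × ℝ →L[ℝ] ℝ := ContinuousLinearMap.fst ℝ ℝ ℝ - m • ContinuousLinearMap.snd ℝ ℝ ℝ

lemma ell_apply (m : ℝ) (x : ℝ × ℝ) : ell m x = x.1 - m * x.2 := by simp [ell]

def Cu (f : ℝ × ℝ → ℝ × ℝ) (σ m s : ℝ) : Prop :=
  ∃ (γ : ℝ → ℝ × ℝ) (C : ℝ), ContinuousOn γ (Ico 0 1) ∧ (∀ t ∈ Ico (0 : ℝ) 1, |ell m (γ t)| ≤ C ∧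
    ‖f (γ t) - σ • γ t‖ ≤ C) ∧ ∀ B, ∃ t ∈ Ico (0 : ℝ) 1, B < s * (γ t).2

def Ba (f : ℝ × ℝ → ℝ × ℝ) (σ m s : ℝ) : Prop :=
  ∃ C : ℝ, ∀ N : ℝ, ∃ v : ℝ → ℝ × ℝ, Continuous v ∧ (∀ τ, N ≤ s * (v τ).2 ∧ ‖f (v τ) - σ • v τ‖ ≤ C) ∧
    Tendsto (fun τ => ell m (v τ)) atTop atTop ∧ Tendsto (fun τ => ell m (v τ)) atBot atBot

theorem crossing {f : ℝ × ℝ → ℝ × ℝ} {σ σ' m s : ℝ} (hs : |s| = 1) (hσ : σ ≠ σ') (h1 : Cu f σ' m s)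
    (h2 : Ba f σ m s) : False := by
  obtain ⟨γ, C, hγ, hγC, hγB⟩ := h1
  obtain ⟨C', hv⟩ := h2
  have hd : 0 < |σ - σ'| := abs_pos.2 (sub_ne_zero.2 hσ)
  obtain ⟨v, hvc, hvN, hvT, hvB⟩ := hv (max (s * (γ 0).2 + 1) ((C + C') / |σ - σ'| + 1))
  obtain ⟨T1, hT1, hT1'⟩ := ((hvB.eventually (eventually_lt_atBot (-C))).and (eventually_lt_atBot 0)).exists
  obtain ⟨T2, hT2, hT2'⟩ := ((hvT.eventually (eventually_gt_atTop C)).and (eventually_gt_atTop 0)).exists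
  obtain ⟨B, hB⟩ := (isCompact_Icc (a := T1) (b := T2)).bddAbove_image (f := fun τ => s * (v τ).2)
    (by fun_prop)
  obtain ⟨t1, ht1, hBt⟩ := hγB B
  have hsub : Icc 0 t1 ⊆ Ico (0 : ℝ) 1 := fun t ht => ⟨ht.1, ht.2.trans_lt ht1.2⟩
  have hγ' : ContinuousOn (fun q : ℝ × ℝ => γ q.2) (Icc T1 T2 ×ˢ Icc 0 t1) :=
    hγ.comp continuousOn_snd (fun q hq => hsub hq.2)
  obtain ⟨τ, hτ, t, ht, e1, e2⟩ := miranda (a := T1) (b := T2) (c := 0) (d := t1) (by linarith) ht1.1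
    (F := fun τ t => ell m (v τ) - ell m (γ t)) (G := fun τ t => s * (γ t).2 - s * (v τ).2)
    (by
      refine ContinuousOn.sub ?_ ((ell m).continuous.comp_continuousOn hγ')
      exact ((ell m).continuous.comp (hvc.comp continuous_fst)).continuousOn)
    (by
      refine ContinuousOn.sub ((continuous_snd.comp_continuousOn hγ').const_mul s |>.congr fun _ _ => rfl) ?_
      exact ((continuous_snd.comp (hvc.comp continuous_fst)).const_mul s).continuousOn)
    (fun t ht => by
      have := (abs_le.1 (hγC t (hsub ht)).1).1
      linarith)
    (fun t ht => by
      have := (abs_le.1 (hγC t (hsub ht)).1).2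
      linarith)
    (fun τ hτ => by
      have := (hvN τ).1
      have := (le_max_left _ _).trans this
      linarith)
    (fun τ hτ => by
      have : s * (v τ).2 ≤ B := hB ⟨τ, hτ, rfl⟩
      linarith)
  have hs0 : s ≠ 0 := by rintro rfl; simp at hs
  have hz2 : (γ t).2 = (v τ).2 := mul_left_cancel₀ hs0 (sub_eq_zero.1 e2)
  have hz1 : (γ t).1 = (v τ).1 := by
    simp only [ell_apply, hz2] at e1
    linarith
  have hz : γ t = v τ := Prod.ext hz1 hz2
  have b1 := (hγC t (hsub ht)).2
  have b2 := (hvN τ).2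
  rw [hz] at b1
  have b3 : ‖(σ - σ') • v τ‖ ≤ C + C' := by
    have : (σ - σ') • v τ = (f (v τ) - σ' • v τ) - (f (v τ) - σ • v τ) := by module
    rw [this]
    exact (norm_sub_le _ _).trans (add_le_add b1 b2)
  rw [norm_smul, Real.norm_eq_abs] at b3
  have b4 : (C + C') / |σ - σ'| + 1 ≤ ‖v τ‖ := by
    refine ((le_max_right _ _).trans (hvN τ).1).trans ?_
    refine (le_abs_self _).trans ?_
    rw [abs_mul, hs, one_mul]
    exact norm_snd_le (v τ)
  have b5 : ‖v τ‖ ≤ (C + C') / |σ - σ'| := by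
    rw [le_div_iff₀ hd]; linarith
  linarith

/-- condensation -/
lemma countable_bad (R : ℝ → ℝ → Prop) (hR : ∀ a b, a ≠ b → R a b ∨ R b a) (J : Set ℝ) (β : ℝ → ℝ × ℝ) :
    {m ∈ J | ¬ ∀ r > 0, ∃ m1 ∈ J, R m1 m ∧ dist (β m1) (β m) < r}.Countable := by
  have : {m ∈ J | ¬ ∀ r > 0, ∃ m1 ∈ J, R m1 m ∧ dist (β m1) (β m) < r} ⊆
      ⋃ n : ℕ, {m ∈ J | ∀ m1 ∈ J, R m1 m → 1 / (n + 1 : ℝ) ≤ dist (β m1) (β m)} := by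
    rintro m ⟨hm, h⟩
    push Not at h
    obtain ⟨r, hr, h⟩ := h
    obtain ⟨n, hn⟩ := exists_nat_one_div_lt hr
    rw [mem_iUnion]
    exact ⟨n, hm, fun m1 hm1 hR => hn.le.trans (h m1 hm1 hR)⟩
  refine Set.Countable.mono this (countable_iUnion fun n => ?_)
  have hpos : (0 : ℝ) < 1 / (n + 1 : ℝ) := by positivity
  refine Set.PairwiseDisjoint.countable_of_isOpen (s := fun m => ball (β m) (1 / (n + 1 : ℝ) / 2)) ?_
    (fun m _ => isOpen_ball) (fun m _ => ⟨β m, mem_ball_self (by positivity)⟩)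
  intro a ha b hb hab
  apply ball_disjoint_ball
  rcases hR a b hab with h | h
  · have := hb.2 a ha.1 h
    linarith
  · have := ha.2 b hb.1 h
    rw [dist_comm] at this
    linarith


theorem maxprin {h : ℝ × ℝ → ℝ × ℝ} {h' : ℝ × ℝ → (ℝ × ℝ) →L[ℝ] (ℝ × ℝ)}
    (hh : ∀ p, HasFDerivAt h (h' p) p) (hp : IsLocalHomeomorph h) {x0 : ℝ × ℝ}
    {δ : ℝ} (hδ : 0 < δ)
    (hev : ∀ p, ∀ l : ℝ, |l| < δ → ∀ v, h' p v = l • v → v = 0)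
    {A C : ℝ × ℝ} (hspan : ∀ v : ℝ × ℝ, ∃ a c : ℝ, v = a • A + c • C)
    (L : (ℝ × ℝ) →L[ℝ] ℝ) (hA : 0 < L A) (hC : 0 < L C) {c1 : ℝ} (hc1 : 0 ≤ c1)
    (hΩ : ∀ s t : ℝ, 0 ≤ s → 0 ≤ t → s * L A + t * L C ≤ c1 → s • A + t • C ∈ Om h x0)
    {e0 R K : ℝ} (he0 : |e0| = 1) (hK : 1 < K * δ)
    (hRA : ∀ s : ℝ, 0 ≤ s → s * L A ≤ c1 → e0 * L (gl h x0 (s • A)) ≤ R)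
    (hRC : ∀ s : ℝ, 0 ≤ s → s * L C ≤ c1 → e0 * L (gl h x0 (s • C)) ≤ R)
    {s t : ℝ} (hs : 0 ≤ s) (ht : 0 ≤ t) (hst : s * L A + t * L C ≤ c1) :
    e0 * L (gl h x0 (s • A + t • C)) ≤ R + K * c1 := by
  have hK0 : 0 < K := by
    by_contra hn
    push Not at hn
    nlinarith
  set T' : Set (ℝ × ℝ) := {q | 0 ≤ q.1 ∧ 0 ≤ q.2 ∧ q.1 * L A + q.2 * L C ≤ c1} with hT'
  set φ : ℝ × ℝ → ℝ × ℝ := fun q => q.1 • A + q.2 • C with hφ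
  have hφc : Continuous φ := by fun_prop
  have hT'c : IsCompact T' := by
    refine IsCompact.of_isClosed_subset
      ((isCompact_Icc (a := (0:ℝ)) (b := c1 / L A)).prod (isCompact_Icc (a := (0:ℝ)) (b := c1 / L C))) ?_ ?_
    · have c1' : Continuous fun q : ℝ × ℝ => q.1 * L A + q.2 * L C := by fun_prop
      exact IsClosed.inter (isClosed_le continuous_const continuous_fst)
        (IsClosed.inter (isClosed_le continuous_const continuous_snd)
        (isClosed_le c1' continuous_const))
    · rintro ⟨a, b⟩ ⟨h1, h2, h3⟩
      simp only at h1 h2 h3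
      refine ⟨⟨h1, ?_⟩, ⟨h2, ?_⟩⟩
      · rw [le_div_iff₀ hA]; nlinarith [mul_nonneg h2 hC.le]
      · rw [le_div_iff₀ hC]; nlinarith [mul_nonneg h1 hA.le]
  have hTΩ : ∀ q ∈ T', φ q ∈ Om h x0 := fun q hq => hΩ q.1 q.2 hq.1 hq.2.1 hq.2.2
  have hLφ : ∀ q, L (φ q) = q.1 * L A + q.2 * L C := by
    intro q; simp [hφ]
  set Ψ : ℝ × ℝ → ℝ := fun y => e0 * L (gl h x0 y) - K * L y with hΨ
  have hcont : ContinuousOn (Ψ ∘ φ) T' := by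
    have h1 : ContinuousOn (fun q => gl h x0 (φ q)) T' :=
      (gl_cont hp).comp hφc.continuousOn hTΩ
    have : ContinuousOn (fun q => e0 * L (gl h x0 (φ q)) - K * L (φ q)) T' :=
      (continuousOn_const.mul (L.continuous.comp_continuousOn h1)).sub
        (continuousOn_const.mul (L.continuous.comp hφc).continuousOn)
    exact this
  have hne : (s, t) ∈ T' := ⟨hs, ht, hst⟩
  obtain ⟨q, hq, hmax⟩ := hT'c.exists_isMaxOn ⟨_, hne⟩ hcont
  have hle : Ψ (φ (s, t)) ≤ Ψ (φ q) := hmax hne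
  have hqs : Ψ (φ q) ≤ R := by
    rcases eq_or_lt_of_le hq.1 with h0 | hq1
    · have h1 := hRC q.2 hq.2.1 (by have := hq.2.2; rw [← h0] at this; linarith)
      have h2 : φ q = q.2 • C := by simp [hφ, ← h0]
      have h3 : 0 ≤ L (φ q) := by
        rw [hLφ]; exact add_nonneg (mul_nonneg hq.1 hA.le) (mul_nonneg hq.2.1 hC.le)
      simp only [hΨ]
      rw [← h2] at h1
      nlinarith [mul_nonneg hK0.le h3]
    rcases eq_or_lt_of_le hq.2.1 with h0 | hq2
    · have h1 := hRA q.1 hq.1 (by have := hq.2.2; rw [← h0] at this; linarith)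
      have h2 : φ q = q.1 • A := by simp [hφ, ← h0]
      have h3 : 0 ≤ L (φ q) := by
        rw [hLφ]; exact add_nonneg (mul_nonneg hq.1 hA.le) (mul_nonneg hq.2.1 hC.le)
      simp only [hΨ]
      rw [← h2] at h1
      nlinarith [mul_nonneg hK0.le h3]
    exfalso
    set y := φ q with hy
    have hyΩ : y ∈ Om h x0 := hTΩ q hq
    have hinj : ∀ v, h' (gl h x0 y) v = 0 → v = 0 := fun v hv =>
      hev _ 0 (by simpa using hδ) v (by simpa using hv)
    obtain ⟨e, he⟩ := exists_equiv (h' (gl h x0 y)) hinj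
    have hde : HasFDerivAt h (e : (ℝ × ℝ) →L[ℝ] (ℝ × ℝ)) (gl h x0 y) := by
      have : (e : (ℝ × ℝ) →L[ℝ] (ℝ × ℝ)) = h' (gl h x0 y) := ContinuousLinearMap.ext fun v => he v
      rw [this]; exact hh _
    have hdg : HasFDerivAt (gl h x0) (e.symm : (ℝ × ℝ) →L[ℝ] (ℝ × ℝ)) y := by
      refine HasFDerivAt.of_local_left_inverse (gl_contAt hp hyΩ) hde ?_
      filter_upwards [(Om_open hp).mem_nhds hyΩ] with z hz
      exact p_gl hp hz
    set lam : (ℝ × ℝ) →L[ℝ] ℝ := e0 • (L.comp (e.symm : (ℝ × ℝ) →L[ℝ] (ℝ × ℝ))) - K • L with hlam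
    have hdΨ : HasFDerivAt Ψ lam y :=
      ((L.hasFDerivAt.comp y hdg).const_mul e0).sub (L.hasFDerivAt.const_mul K)
    set T := φ '' T' with hT
    have hTmax : IsMaxOn Ψ T y := by
      rintro _ ⟨q', hq', rfl⟩
      exact hmax hq'
    have hT'conv : Convex ℝ T' := by
      rintro ⟨a1, a2⟩ ⟨h1, h2, h3⟩ ⟨b1, b2⟩ ⟨k1, k2, k3⟩ u v hu hv huv
      simp only at h1 h2 h3 k1 k2 k3
      refine ⟨?_, ?_, ?_⟩ <;> simp only [Prod.smul_mk, Prod.mk_add_mk, smul_eq_mul]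
      · positivity
      · positivity
      · have : v = 1 - u := by linarith
        nlinarith [mul_le_mul_of_nonneg_left h3 hu, mul_le_mul_of_nonneg_left k3 hv]
    have hTconv : Convex ℝ T := by
      have : IsLinearMap ℝ φ := by
        constructor
        · intro x z; simp [hφ, add_smul]; abel
        · intro c x; simp [hφ, mul_smul, smul_add]
      exact hT'conv.is_linear_image this
    have key : ∀ z ∈ T, lam (z - y) ≤ 0 := by
      intro z hz
      refine (hTmax.localize).hasFDerivWithinAt_nonpos hdΨ.hasFDerivWithinAt ?_
      exact sub_mem_posTangentConeAt_of_segment_subset (hTconv.segment_subset ⟨q, hq, rfl⟩ hz)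
    have hLy : 0 < L y := by
      rw [hy, hLφ]; have := mul_pos hq1 hA; have := mul_pos hq2 hC; linarith
    have k0 := key 0 ⟨(0, 0), ⟨le_rfl, le_rfl, by simpa using hc1⟩, by simp [hφ]⟩
    obtain ⟨η, hη, hη1, hη2⟩ : ∃ η > 0, η * L C ≤ q.1 ∧ η * L A ≤ q.2 := by
      refine ⟨min (q.1 / L C) (q.2 / L A), lt_min (div_pos hq1 hC) (div_pos hq2 hA), ?_, ?_⟩
      · rw [← le_div_iff₀ hC]; exact min_le_left _ _
      · rw [← le_div_iff₀ hA]; exact min_le_right _ _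
    have k1 := key (φ (q.1 + η * L C, q.2 - η * L A))
      ⟨_, ⟨by simp only; nlinarith [mul_pos hη hC], by simp only; linarith, by simp only; linarith [hq.2.2]⟩, rfl⟩
    have k2 := key (φ (q.1 - η * L C, q.2 + η * L A))
      ⟨_, ⟨by simp only; linarith, by simp only; nlinarith [mul_pos hη hA], by simp only; linarith [hq.2.2]⟩, rfl⟩
    have e1 : φ (q.1 + η * L C, q.2 - η * L A) - y = η • (L C • A - L A • C) := by
      simp only [hy, hφ]; module
    have e2 : φ (q.1 - η * L C, q.2 + η * L A) - y = -(η • (L C • A - L A • C)) := by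
      simp only [hy, hφ]; module
    rw [e1, map_smul, smul_eq_mul] at k1
    rw [e2, map_neg, map_smul, smul_eq_mul] at k2
    have kw : lam (L C • A - L A • C) = 0 := by
      have : η * lam (L C • A - L A • C) = 0 := by linarith
      exact (mul_eq_zero.1 this).resolve_left hη.ne'
    simp only [zero_sub, map_neg] at k0
    set N : (ℝ × ℝ) →L[ℝ] ℝ := L.comp (e.symm : (ℝ × ℝ) →L[ℝ] (ℝ × ℝ)) with hN
    have hlam' : ∀ v, lam v = e0 * N v - K * L v := fun v => by simp [hlam]
    have he0' : e0 ≠ 0 := by rintro rfl; simp at he0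
    rw [hlam', map_sub, map_sub, map_smul, map_smul, map_smul, map_smul] at kw
    simp only [smul_eq_mul] at kw
    have kw' : L C * N A = L A * N C := by
      have : e0 * (L C * N A - L A * N C) = 0 := by linarith
      have := (mul_eq_zero.1 this).resolve_left he0'
      linarith
    rw [hlam'] at k0
    set μ := N y / L y with hμ
    have hNy : N y = q.1 * N A + q.2 * N C := by rw [hy]; simp only [hφ, map_add, map_smul, smul_eq_mul]
    have hLy2 : L y = q.1 * L A + q.2 * L C := by rw [hy, hLφ]
    have hNA : N A = μ * L A := by
      rw [hμ, div_mul_eq_mul_div, eq_div_iff hLy.ne', hNy, hLy2]; linear_combination q.2 * kw'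
    have hNC : N C = μ * L C := by
      rw [hμ, div_mul_eq_mul_div, eq_div_iff hLy.ne', hNy, hLy2]; linear_combination -q.1 * kw'
    have hNv : ∀ v, N v = μ * L v := by
      intro v
      obtain ⟨a, c, rfl⟩ := hspan v
      simp only [map_add, map_smul, smul_eq_mul, hNA, hNC]; ring
    have hμK : K ≤ |μ| := by
      have h1 : K ≤ e0 * μ := by
        have h2 : e0 * N y = e0 * μ * L y := by rw [hNv y]; ring
        by_contra hn
        push Not at hn
        nlinarith [mul_lt_mul_of_pos_right hn hLy]
      calc K ≤ e0 * μ := h1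
        _ ≤ |e0 * μ| := le_abs_self _
        _ = |μ| := by rw [abs_mul, he0, one_mul]
    have hμ0 : 0 < |μ| := lt_of_lt_of_le hK0 hμK
    have hμne : μ ≠ 0 := abs_pos.1 hμ0
    let D : (ℝ × ℝ) →ₗ[ℝ] (ℝ × ℝ) := (h' (gl h x0 y)).toLinearMap - μ⁻¹ • LinearMap.id
    have hD : ∀ v, D v = h' (gl h x0 y) v - μ⁻¹ • v := fun v => rfl
    have hDinj : Injective D := by
      rw [injective_iff_map_eq_zero]
      intro v hv
      rw [hD, sub_eq_zero] at hv
      refine hev _ μ⁻¹ ?_ v hv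
      rw [abs_inv, inv_lt_comm₀ hμ0 hδ]
      refine lt_of_lt_of_le ?_ hμK
      rw [inv_lt_iff_one_lt_mul₀ hδ]; linarith
    obtain ⟨v, hv⟩ := (LinearMap.injective_iff_surjective.1 hDinj) y
    have : L (D v) = 0 := by
      rw [hD, map_sub, map_smul, ← he]
      have h3 := hNv (e v)
      have h4 : N (e v) = L v := by simp [hN]
      rw [h4] at h3
      rw [h3, smul_eq_mul]; field_simp; ring
    rw [hv] at this
    linarith
  have h5 : Ψ (φ (s, t)) ≤ R := hle.trans hqs
  have h6 : L (φ (s, t)) ≤ c1 := by rw [hLφ]; exact hst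
  simp only [hΨ] at h5
  have : e0 * L (gl h x0 (φ (s, t))) ≤ R + K * c1 := by nlinarith
  exact this


def Dat (f : ℝ × ℝ → ℝ × ℝ) (σ j1 j2 : ℝ) : Prop :=
  ∃ (h : ℝ × ℝ → ℝ × ℝ) (x0 y0 : ℝ × ℝ) (Kc : Set (ℝ × ℝ)) (β : ℝ → ℝ × ℝ) (C e : ℝ),
    |e| = 1 ∧ IsLocalHomeomorph h ∧ (∀ x, h x = f x - σ • x - y0) ∧ h x0 = 0 ∧
    (∀ u ∈ Kc, ∀ v ∈ Kc, ∀ s t : ℝ, 0 ≤ s → 0 ≤ t → s • u + t • v ∈ Kc) ∧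
    ∀ m ∈ Ioo j1 j2, β m ∈ Kc ∧ β m ∉ Om h x0 ∧ 0 < e * ell m (β m) ∧ ‖β m‖ ≤ C ∧
      ∀ y ∈ Kc, e * ell m y < e * ell m (β m) →
        y ∈ Om h x0 ∧ |ell m (gl h x0 y)| ≤ C ∧ ‖y‖ ≤ C

theorem nonconv_data {h : ℝ × ℝ → ℝ × ℝ} (hp : IsLocalHomeomorph h) {x0 : ℝ × ℝ} (h0 : h x0 = 0)
    (hnc : ¬ Convex ℝ (Om h x0)) :
    ∃ A ∈ Om h x0, ∃ C ∈ Om h x0, ∃ u v : ℝ, 0 ≤ u ∧ 0 ≤ v ∧ u + v < 1 ∧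
      u • A + v • C ∉ Om h x0 ∧ A.2 ≠ C.2 ∧ A.1 * C.2 - A.2 * C.1 ≠ 0 := by
  have hstar : ∀ y ∈ Om h x0, ∀ t : ℝ, 0 ≤ t → t ≤ 1 → t • y ∈ Om h x0 := by
    intro y hy t ht0 ht1
    have := Om_star' hp hy ⟨ht0, ht1⟩
    simpa [h0] using this
  simp only [Convex, StarConvex] at hnc
  push Not at hnc
  obtain ⟨a, ha, c, hc, u, v, hu, hv, huv, hb⟩ := hnc
  have hdet : a.1 * c.2 - a.2 * c.1 ≠ 0 := by
    intro hd
    apply hb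
    by_cases ha0 : a = 0
    · rw [ha0, smul_zero, zero_add]
      exact hstar c hc v hv (by linarith)
    obtain ⟨k, hk⟩ : ∃ k : ℝ, c = k • a := by
      by_cases h1 : a.1 = 0
      · have h2 : a.2 ≠ 0 := fun h2 => ha0 (Prod.ext h1 h2)
        refine ⟨c.2 / a.2, Prod.ext ?_ ?_⟩
        · rw [h1] at hd
          have : c.1 = 0 := by
            have : a.2 * c.1 = 0 := by linarith
            exact (mul_eq_zero.1 this).resolve_left h2
          simp [this, h1]
        · simp [h2]
      · refine ⟨c.1 / a.1, Prod.ext ?_ ?_⟩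
        · simp [h1]
        · simp only [Prod.smul_snd, smul_eq_mul]
          field_simp
          linarith
    have e1 : u • a + v • c = (u + v * k) • a := by rw [hk]; module
    by_cases hk1 : 0 ≤ u + v * k ∧ u + v * k ≤ 1
    · rw [e1]; exact hstar a ha _ hk1.1 hk1.2
    · have hk0 : k ≠ 0 := by
        rintro rfl
        exact hk1 ⟨by simpa using hu, by simp; linarith⟩
      have e2 : u • a + v • c = ((u + v * k) / k) • c := by
        rw [e1, hk, smul_smul]; congr 1; field_simp
      rw [e2]
      rcases lt_or_gt_of_ne hk0 with hneg | hpos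
      · have h3 : u + v * k < 0 := by
          by_contra hh
          push Not at hh
          exact hk1 ⟨hh, by nlinarith⟩
        refine hstar c hc _ (div_nonneg_of_nonpos h3.le hneg.le) ?_
        rw [div_le_one_of_neg hneg]
        nlinarith
      · have h3 : 1 < u + v * k := by
          by_contra hh
          push Not at hh
          exact hk1 ⟨by positivity, hh⟩
        refine hstar c hc _ (by positivity) ?_
        rw [div_le_one hpos]
        have hk2 : 1 < k := by
          by_contra hh
          push Not at hh
          nlinarith [mul_le_mul_of_nonneg_left hh hv]
        have hu1 : u = 1 - v := by linarith
        nlinarith [mul_le_mul_of_nonneg_left hk2.le hu]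
  have hex : ∀ y ∈ Om h x0, ∃ z : ℝ, 1 < z ∧ z • y ∈ Om h x0 := by
    intro y hy
    have hcts : Continuous fun z : ℝ => z • y := by fun_prop
    have : ∀ᶠ z in 𝓝 (1:ℝ), z • y ∈ Om h x0 :=
      hcts.continuousAt.eventually ((Om_open hp).mem_nhds (by simpa using hy))
    have h2 : ∀ᶠ z in 𝓝[>] (1:ℝ), z • y ∈ Om h x0 := this.filter_mono nhdsWithin_le_nhds
    obtain ⟨z, hz, hz1⟩ := (h2.and self_mem_nhdsWithin).exists
    exact ⟨z, hz1, hz⟩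
  obtain ⟨z2, hz2, hC⟩ := hex c hc
  obtain ⟨z1, hz1, hA, hne⟩ : ∃ z1 : ℝ, 1 < z1 ∧ z1 • a ∈ Om h x0 ∧ z1 * a.2 ≠ z2 * c.2 := by
    obtain ⟨z, hz, hA⟩ := hex a ha
    by_cases hzz : z * a.2 = z2 * c.2
    · refine ⟨(1 + z) / 2, by linarith, ?_, ?_⟩
      · have := hstar _ hA (((1 + z) / 2) / z) (by positivity) (by rw [div_le_one (by linarith)]; linarith)
        rw [smul_smul] at this
        convert! this using 2
        field_simp
      · intro h3
        have h4 : (z - 1) * a.2 = 0 := by nlinarith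
        have h5 := (mul_eq_zero.1 h4).resolve_left (by linarith)
        rw [h5] at hzz hdet
        have h6 : c.2 = 0 := by
          have : z2 * c.2 = 0 := by linarith
          exact (mul_eq_zero.1 this).resolve_left (by linarith)
        rw [h6] at hdet; simp at hdet
    · exact ⟨z, hz, hA, hzz⟩
  have p1 : 0 < z1 := by linarith
  have p2 : 0 < z2 := by linarith
  refine ⟨z1 • a, hA, z2 • c, hC, u / z1, v / z2, by positivity, by positivity, ?_, ?_, by simpa using hne, ?_⟩
  · have h1 : u / z1 ≤ u := div_le_self hu hz1.le
    have h2 : v / z2 ≤ v := div_le_self hv hz2.le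
    rcases hu.lt_or_eq with h3 | h3
    · have : u / z1 < u := div_lt_self h3 hz1
      linarith
    · have : v / z2 < v := div_lt_self (by linarith) hz2
      linarith
  · have : (u / z1) • z1 • a + (v / z2) • z2 • c = u • a + v • c := by
      rw [smul_smul, smul_smul, div_mul_cancel₀ _ p1.ne', div_mul_cancel₀ _ p2.ne']
    rwa [this]
  · simp only [Prod.smul_fst, Prod.smul_snd, smul_eq_mul]
    have : z1 * a.1 * (z2 * c.2) - z1 * a.2 * (z2 * c.1) = (z1 * z2) * (a.1 * c.2 - a.2 * c.1) := by ring
    rw [this]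
    exact mul_ne_zero (by positivity) hdet

theorem abs_ell_le (m : ℝ) (x : ℝ × ℝ) : |ell m x| ≤ (1 + |m|) * ‖x‖ := by
  rw [ell_apply]
  have h1 : |x.1| ≤ ‖x‖ := norm_fst_le x
  have h2 : |x.2| ≤ ‖x‖ := norm_snd_le x
  calc |x.1 - m * x.2| ≤ |x.1| + |m * x.2| := abs_sub _ _
    _ = |x.1| + |m| * |x.2| := by rw [abs_mul]
    _ ≤ (1 + |m|) * ‖x‖ := by nlinarith [mul_le_mul_of_nonneg_left h2 (abs_nonneg m)]

theorem mk_Dat {f h : ℝ × ℝ → ℝ × ℝ} {h' : ℝ × ℝ → (ℝ × ℝ) →L[ℝ] (ℝ × ℝ)}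
    (hh : ∀ p, HasFDerivAt h (h' p) p) (hp : IsLocalHomeomorph h) {x0 y0 : ℝ × ℝ} {σ : ℝ}
    (hf : ∀ x, h x = f x - σ • x - y0) (h0 : h x0 = 0)
    {δ : ℝ} (hδ : 0 < δ)
    (hev : ∀ p, ∀ l : ℝ, |l| < δ → ∀ v, h' p v = l • v → v = 0)
    (hnc : ¬ Convex ℝ (Om h x0)) : ∃ j1 j2 : ℚ, j1 < j2 ∧ Dat f σ j1 j2 := by
  obtain ⟨A, hA, C, hC, u, v, hu, hv, huv, hb, hne, hdet⟩ := nonconv_data hp h0 hnc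
  have hstar : ∀ y ∈ Om h x0, ∀ t : ℝ, 0 ≤ t → t ≤ 1 → t • y ∈ Om h x0 := by
    intro y hy t ht0 ht1
    have := Om_star' hp hy ⟨ht0, ht1⟩
    simpa [h0] using this
  have h0Ω : (0 : ℝ × ℝ) ∈ Om h x0 := by
    have := Om_base (p := h) (x0 := x0)
    rwa [h0] at this
  have hspan : ∀ w : ℝ × ℝ, ∃ a c : ℝ, w = a • A + c • C := by
    intro w
    refine ⟨(w.1 * C.2 - w.2 * C.1) / (A.1 * C.2 - A.2 * C.1),
      (A.1 * w.2 - A.2 * w.1) / (A.1 * C.2 - A.2 * C.1), Prod.ext ?_ ?_⟩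
    · simp only [Prod.fst_add, Prod.smul_fst, smul_eq_mul]
      rw [div_mul_eq_mul_div, div_mul_eq_mul_div, ← add_div, eq_div_iff hdet]; ring
    · simp only [Prod.snd_add, Prod.smul_snd, smul_eq_mul]
      rw [div_mul_eq_mul_div, div_mul_eq_mul_div, ← add_div, eq_div_iff hdet]; ring
  set b0 := u • A + v • C with hb0
  have hD : C.2 - A.2 ≠ 0 := sub_ne_zero.2 hne.symm
  set m0 := (C.1 - A.1) / (C.2 - A.2) with hm0
  have hAC : ell m0 A = ell m0 C := by
    rw [ell_apply, ell_apply]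
    have : m0 * (C.2 - A.2) = C.1 - A.1 := by rw [hm0, div_mul_cancel₀ _ hD]
    linarith
  have hA0 : ell m0 A ≠ 0 := by
    intro h1
    obtain ⟨a, c, hw⟩ := hspan (1, 0)
    have h2 : ell m0 ((1, 0) : ℝ × ℝ) = 0 := by
      rw [hw, map_add, map_smul, map_smul, ← hAC, h1]; simp
    rw [ell_apply] at h2
    simp at h2
  obtain ⟨e, he, heA⟩ : ∃ e : ℝ, |e| = 1 ∧ 0 < e * ell m0 A := by
    rcases lt_or_gt_of_ne hA0 with h1 | h1
    · exact ⟨-1, by simp, by linarith⟩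
    · exact ⟨1, by simp, by linarith⟩
  have hcm : ∀ x : ℝ × ℝ, Continuous fun m : ℝ => e * ell m x := by
    intro x; simp only [ell_apply]; fun_prop
  have hb0m : ∀ m, e * ell m b0 = u * (e * ell m A) + v * (e * ell m C) := by
    intro m; rw [hb0, map_add, map_smul, map_smul, smul_eq_mul, smul_eq_mul]; ring
  have ev : ∀ᶠ m in 𝓝 m0, (0 < e * ell m A ∧ 0 < e * ell m C) ∧
      (e * ell m b0 < e * ell m A ∧ e * ell m b0 < e * ell m C) ∧ |m| < |m0| + 1 := by
    have q1 : e * ell m0 b0 < e * ell m0 A := by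
      rw [hb0m, ← hAC]; nlinarith
    refine ((continuousAt_const.eventually_lt (hcm A).continuousAt heA).and
      (continuousAt_const.eventually_lt (hcm C).continuousAt (by rwa [← hAC]))).and
      ((((hcm b0).continuousAt.eventually_lt (hcm A).continuousAt q1).and
      ((hcm b0).continuousAt.eventually_lt (hcm C).continuousAt (by rwa [← hAC]))).and
      (continuous_abs.continuousAt.eventually_lt continuousAt_const (by linarith)))
  obtain ⟨r, hr, hball⟩ := Metric.eventually_nhds_iff.1 ev
  obtain ⟨j1, hj1, hj1'⟩ := exists_rat_btwn (show m0 - r < m0 by linarith)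
  obtain ⟨j2, hj2, hj2'⟩ := exists_rat_btwn (show m0 < m0 + r by linarith)
  refine ⟨j1, j2, by exact_mod_cast hj1'.trans hj2, ?_⟩
  have hJ : ∀ m ∈ Ioo (j1:ℝ) j2, (0 < e * ell m A ∧ 0 < e * ell m C) ∧
      (e * ell m b0 < e * ell m A ∧ e * ell m b0 < e * ell m C) ∧ |m| < |m0| + 1 := by
    intro m hm
    refine hball ?_
    rw [Real.dist_eq, abs_lt]
    exact ⟨by linarith [hm.1], by linarith [hm.2]⟩
  -- minimizer
  have hβ : ∀ m : ℝ, ∃ q : ℝ × ℝ, m ∈ Ioo (j1:ℝ) j2 →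
      (q.1 ∈ Icc (0:ℝ) 1 ∧ q.2 ∈ Icc (0:ℝ) 1 ∧ q.1 • A + q.2 • C ∉ Om h x0 ∧
        e * ell m (q.1 • A + q.2 • C) ≤ e * ell m b0) ∧
      ∀ s t : ℝ, s ∈ Icc (0:ℝ) 1 → t ∈ Icc (0:ℝ) 1 → s • A + t • C ∉ Om h x0 →
        e * ell m (s • A + t • C) ≤ e * ell m b0 →
        e * ell m (q.1 • A + q.2 • C) ≤ e * ell m (s • A + t • C) := by
    intro m
    by_cases hm : m ∈ Ioo (j1:ℝ) j2
    swap
    · exact ⟨0, fun h => absurd h hm⟩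
    have hφ : Continuous fun q : ℝ × ℝ => q.1 • A + q.2 • C := by fun_prop
    have hψ : Continuous fun q : ℝ × ℝ => e * ell m (q.1 • A + q.2 • C) :=
      continuous_const.mul ((ell m).continuous.comp hφ)
    set S : Set (ℝ × ℝ) := (Icc (0:ℝ) 1 ×ˢ Icc (0:ℝ) 1) ∩
      ({q | q.1 • A + q.2 • C ∉ Om h x0} ∩ {q | e * ell m (q.1 • A + q.2 • C) ≤ e * ell m b0}) with hS
    have hSc : IsCompact S := by
      refine (isCompact_Icc.prod isCompact_Icc).inter_right (IsClosed.inter ?_ ?_)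
      · exact (Om_open hp).isClosed_compl.preimage hφ
      · exact isClosed_le hψ continuous_const
    have hSne : S.Nonempty := by
      refine ⟨(u, v), ⟨⟨⟨hu, by linarith⟩, ⟨hv, by linarith⟩⟩, hb, ?_⟩⟩
      exact le_refl (e * ell m b0)
    obtain ⟨q, hq, hmin⟩ := hSc.exists_isMinOn hSne hψ.continuousOn
    refine ⟨q, fun _ => ⟨⟨hq.1.1, hq.1.2, hq.2.1, hq.2.2⟩, ?_⟩⟩
    intro s t hs ht h1 h2
    exact hmin (show (s, t) ∈ S from ⟨⟨hs, ht⟩, h1, h2⟩)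
  choose q hq using hβ
  -- edge bounds
  have hedge : ∀ y ∈ Om h x0, ∃ R, ∀ s ∈ Icc (0:ℝ) 1, ‖gl h x0 (s • y)‖ ≤ R := by
    intro y hy
    have hc : ContinuousOn (fun s : ℝ => gl h x0 (s • y)) (Icc 0 1) :=
      (gl_cont hp).comp (by fun_prop) fun s hs => hstar y hy s hs.1 hs.2
    exact isCompact_Icc.exists_bound_of_continuousOn hc
  obtain ⟨RA, hRA⟩ := hedge A hA
  obtain ⟨RC, hRC⟩ := hedge C hC
  set M := 2 + |m0| with hM
  have hM0 : 0 < M := by positivity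
  set R0 := max RA RC with hR0
  have hR0n : 0 ≤ R0 := (norm_nonneg _).trans ((hRA 0 (by simp)).trans (le_max_left _ _))
  set K := 2 / δ with hK
  have hKp : 0 < K := by positivity
  have hKδ : 1 < K * δ := by rw [hK, div_mul_cancel₀ _ hδ.ne']; norm_num
  set B := M * R0 + K * (M * ‖A‖) + ‖A‖ + ‖C‖ with hB
  set Kc : Set (ℝ × ℝ) := {y | ∃ s t : ℝ, 0 ≤ s ∧ 0 ≤ t ∧ y = s • A + t • C} with hKc
  refine ⟨h, x0, y0, Kc, fun m => (q m).1 • A + (q m).2 • C, B, e, he, hp, hf, h0, ?_, ?_⟩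
  · rintro _ ⟨s1, t1, hs1, ht1, rfl⟩ _ ⟨s2, t2, hs2, ht2, rfl⟩ s t hs ht
    exact ⟨s * s1 + t * s2, s * t1 + t * t2, by positivity, by positivity, by module⟩
  intro m hm
  obtain ⟨⟨hq1, hq2, hqΩ, hqb⟩, hqmin⟩ := hq m hm
  obtain ⟨⟨hmA, hmC⟩, ⟨hmbA, hmbC⟩, hmabs⟩ := hJ m hm
  have hexp : ∀ s t : ℝ, e * ell m (s • A + t • C) = s * (e * ell m A) + t * (e * ell m C) := by
    intro s t; rw [map_add, map_smul, map_smul, smul_eq_mul, smul_eq_mul]; ring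
  have hnorm : ∀ s t : ℝ, s ∈ Icc (0:ℝ) 1 → t ∈ Icc (0:ℝ) 1 → ‖s • A + t • C‖ ≤ ‖A‖ + ‖C‖ := by
    intro s t hs ht
    refine (norm_add_le _ _).trans ?_
    rw [norm_smul, norm_smul, Real.norm_eq_abs, Real.norm_eq_abs, abs_of_nonneg hs.1, abs_of_nonneg ht.1]
    nlinarith [norm_nonneg A, norm_nonneg C, hs.2, ht.2, mul_le_mul_of_nonneg_right hs.2 (norm_nonneg A), mul_le_mul_of_nonneg_right ht.2 (norm_nonneg C)]
  have hBge : ‖A‖ + ‖C‖ ≤ B := by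
    have : 0 ≤ M * R0 + K * (M * ‖A‖) := by positivity
    linarith
  have hBge2 : M * R0 + K * (M * ‖A‖) ≤ B := by
    linarith [norm_nonneg A, norm_nonneg C]
  refine ⟨⟨_, _, hq1.1, hq2.1, rfl⟩, hqΩ, ?_, (hnorm _ _ hq1 hq2).trans hBge, ?_⟩
  · show 0 < e * ell m ((q m).1 • A + (q m).2 • C)
    rw [hexp]
    rcases hq1.1.lt_or_eq with h1 | h1
    · exact add_pos_of_pos_of_nonneg (mul_pos h1 hmA) (mul_nonneg hq2.1 hmC.le)
    rcases hq2.1.lt_or_eq with h2 | h2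
    · exact add_pos_of_nonneg_of_pos (mul_nonneg hq1.1 hmA.le) (mul_pos h2 hmC)
    · exfalso; apply hqΩ; rw [← h1, ← h2]; simpa using h0Ω
  -- points below
  have hbox : ∀ s t : ℝ, 0 ≤ s → 0 ≤ t → e * ell m (s • A + t • C) ≤ e * ell m b0 →
      s ∈ Icc (0:ℝ) 1 ∧ t ∈ Icc (0:ℝ) 1 := by
    intro s t hs ht h1
    rw [hexp] at h1
    refine ⟨⟨hs, ?_⟩, ⟨ht, ?_⟩⟩
    · by_contra hn
      push Not at hn
      nlinarith [mul_nonneg ht hmC.le, mul_lt_mul_of_pos_right hn hmA]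
    · by_contra hn
      push Not at hn
      nlinarith [mul_nonneg hs hmA.le, mul_lt_mul_of_pos_right hn hmC]
  have hin : ∀ s t : ℝ, 0 ≤ s → 0 ≤ t →
      e * ell m (s • A + t • C) < e * ell m ((q m).1 • A + (q m).2 • C) →
      s • A + t • C ∈ Om h x0 := by
    intro s t hs ht h1
    by_contra hn
    obtain ⟨b1, b2⟩ := hbox s t hs ht (h1.le.trans hqb)
    exact absurd (hqmin s t b1 b2 hn (h1.le.trans hqb)) (not_le.2 h1)
  rintro _ ⟨s, t, hs, ht, rfl⟩ hlt
  have hlt' : e * ell m (s • A + t • C) < e * ell m ((q m).1 • A + (q m).2 • C) := hlt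
  obtain ⟨b1, b2⟩ := hbox s t hs ht (hlt'.le.trans hqb)
  refine ⟨hin s t hs ht hlt', ?_, (hnorm s t b1 b2).trans hBge⟩
  set L : (ℝ × ℝ) →L[ℝ] ℝ := e • ell m with hL
  have hLx : ∀ x, L x = e * ell m x := fun x => rfl
  have hLabs : ∀ x, |L x| ≤ M * ‖x‖ := by
    intro x
    rw [hLx, abs_mul, he, one_mul]
    refine (abs_ell_le m x).trans ?_
    exact mul_le_mul_of_nonneg_right (by linarith) (norm_nonneg _)
  have hmp : ∀ e0 : ℝ, |e0| = 1 → e0 * L (gl h x0 (s • A + t • C)) ≤ M * R0 + K * L (s • A + t • C) := by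
    intro e0 he0
    have hLst : L (s • A + t • C) = s * L A + t * L C := by simp
    refine maxprin hh hp hδ hev hspan L hmA hmC (c1 := L (s • A + t • C)) ?_ ?_ he0 hKδ ?_ ?_ hs ht hLst.ge
    · rw [hLst]; exact add_nonneg (mul_nonneg hs hmA.le) (mul_nonneg ht hmC.le)
    · intro s' t' hs' ht' h1
      refine hin s' t' hs' ht' ?_
      rw [hexp]
      exact lt_of_le_of_lt h1 hlt'
    · intro s' hs' h1
      have b := (hbox s' 0 hs' le_rfl (by
        rw [hexp]; have h2 : s' * L A ≤ e * ell m b0 := h1.trans (hlt'.le.trans hqb)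
        rw [hLx] at h2; linarith)).1
      calc e0 * L (gl h x0 (s' • A)) ≤ |e0 * L (gl h x0 (s' • A))| := le_abs_self _
        _ = |L (gl h x0 (s' • A))| := by rw [abs_mul, he0, one_mul]
        _ ≤ M * ‖gl h x0 (s' • A)‖ := hLabs _
        _ ≤ M * R0 := mul_le_mul_of_nonneg_left ((hRA s' b).trans (le_max_left _ _)) hM0.le
    · intro s' hs' h1
      have b := (hbox 0 s' le_rfl hs' (by
        rw [hexp]; have h2 : s' * L C ≤ e * ell m b0 := h1.trans (hlt'.le.trans hqb)
        rw [hLx] at h2; linarith)).2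
      calc e0 * L (gl h x0 (s' • C)) ≤ |e0 * L (gl h x0 (s' • C))| := le_abs_self _
        _ = |L (gl h x0 (s' • C))| := by rw [abs_mul, he0, one_mul]
        _ ≤ M * ‖gl h x0 (s' • C)‖ := hLabs _
        _ ≤ M * R0 := mul_le_mul_of_nonneg_left ((hRC s' b).trans (le_max_right _ _)) hM0.le
  have hLle : L (s • A + t • C) ≤ M * ‖A‖ :=
    ((hlt'.le.trans hqb).trans hmbA.le).trans ((le_abs_self _).trans (hLabs A))
  have h1 := hmp 1 (by simp)
  have h2 := hmp (-1) (by simp)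
  have h3 : |ell m (gl h x0 (s • A + t • C))| = |L (gl h x0 (s • A + t • C))| := by
    rw [hLx, abs_mul, he, one_mul]
  rw [h3]
  have h4 : K * L (s • A + t • C) ≤ K * (M * ‖A‖) := mul_le_mul_of_nonneg_left hLle hKp.le
  rw [abs_le]
  constructor <;> linarith


theorem sign_const {X : Type*} [TopologicalSpace X] {S : Set X} (hS : IsPreconnected S) {g : X → ℝ}
    (hg : ContinuousOn g S) (h0 : ∀ x ∈ S, g x ≠ 0) {s : ℝ} (hs : |s| = 1) {a : X} (ha : a ∈ S)
    (hsa : 0 < s * g a) {x : X} (hx : x ∈ S) : s * g x = |g x| := by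
  have hs0 : s ≠ 0 := by rintro rfl; simp at hs
  have hpos : 0 < s * g x := by
    by_contra hn
    push Not at hn
    have hc : ContinuousOn (fun x => s * g x) S := continuousOn_const.mul hg
    obtain ⟨z, hz, hz0⟩ := hS.intermediate_value hx ha hc ⟨hn, hsa.le⟩
    exact mul_ne_zero hs0 (h0 z hz) hz0
  have : |s * g x| = |g x| := by rw [abs_mul, hs, one_mul]
  rw [← this, abs_of_pos hpos]

def DB (h : ℝ × ℝ → ℝ × ℝ) (x0 : ℝ × ℝ) (Kc : Set (ℝ × ℝ)) (β : ℝ → ℝ × ℝ) (C e j1 j2 : ℝ) : Prop :=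
    ∀ m ∈ Ioo j1 j2, β m ∈ Kc ∧ β m ∉ Om h x0 ∧ 0 < e * ell m (β m) ∧ ‖β m‖ ≤ C ∧
      ∀ y ∈ Kc, e * ell m y < e * ell m (β m) →
        y ∈ Om h x0 ∧ |ell m (gl h x0 y)| ≤ C ∧ ‖y‖ ≤ C

theorem DB_ray {h : ℝ × ℝ → ℝ × ℝ} {x0 : ℝ × ℝ} {Kc : Set (ℝ × ℝ)}
    {β : ℝ → ℝ × ℝ} {C e j1 j2 : ℝ}
    (hK : ∀ u ∈ Kc, ∀ v ∈ Kc, ∀ s t : ℝ, 0 ≤ s → 0 ≤ t → s • u + t • v ∈ Kc)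
    (hD : DB h x0 Kc β C e j1 j2) {m : ℝ} (hm : m ∈ Ioo j1 j2) {t : ℝ} (ht : t ∈ Ico (0:ℝ) 1) :
    t • β m ∈ Kc ∧ e * ell m (t • β m) < e * ell m (β m) := by
  obtain ⟨h1, -, h3, -, -⟩ := hD m hm
  refine ⟨by simpa using hK _ h1 _ h1 t 0 ht.1 le_rfl, ?_⟩
  rw [map_smul, smul_eq_mul]
  nlinarith [mul_lt_mul_of_pos_right ht.2 h3]

theorem DB_blow {h : ℝ × ℝ → ℝ × ℝ} (hp : IsLocalHomeomorph h) {x0 : ℝ × ℝ} (h0 : h x0 = 0)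
    {Kc : Set (ℝ × ℝ)} {β : ℝ → ℝ × ℝ} {C e j1 j2 : ℝ}
    (hK : ∀ u ∈ Kc, ∀ v ∈ Kc, ∀ s t : ℝ, 0 ≤ s → 0 ≤ t → s • u + t • v ∈ Kc)
    (hD : DB h x0 Kc β C e j1 j2) {m : ℝ} (hm : m ∈ Ioo j1 j2) (N : ℝ) :
    ∃ r > 0, ∀ y, dist y (β m) < r → ∀ m' ∈ Ioo j1 j2, y ∈ Kc →
      e * ell m' y < e * ell m' (β m') → N < |(gl h x0 y).2| := by
  obtain ⟨-, hb, -, -, hbel⟩ := hD m hm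
  have hseg : ∀ t ∈ Ico (0:ℝ) 1, h x0 + t • (β m - h x0) ∈ Om h x0 := by
    intro t ht
    rw [h0, sub_zero, zero_add]
    obtain ⟨k1, k2⟩ := DB_ray hK hD hm ht
    exact (hbel _ k1 k2).1
  set M := |j1| + |j2| with hM
  have hM0 : 0 ≤ M := by positivity
  have hev : ∀ᶠ y in 𝓝[Om h x0] (β m), C + (M + 1) * |N| < ‖gl h x0 y‖ := by
    by_contra hn
    rw [not_eventually] at hn
    have hf : ∃ᶠ y in 𝓝[Om h x0] (β m), gl h x0 y ∈ closedBall (0 : ℝ × ℝ) (C + (M + 1) * |N|) := by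
      refine hn.mono fun y hy => ?_
      rw [mem_closedBall, dist_zero_right]
      exact not_lt.1 hy
    obtain ⟨z, -, hz⟩ := (isCompact_closedBall _ _).exists_mapClusterPt_of_frequently hf
    exact no_cluster hp hb hseg z hz
  rw [eventually_nhdsWithin_iff, Metric.eventually_nhds_iff] at hev
  obtain ⟨r, hr, hball⟩ := hev
  refine ⟨r, hr, fun y hy m' hm' hyK hlt => ?_⟩
  obtain ⟨-, -, -, -, hbel'⟩ := hD m' hm'
  obtain ⟨k1, k2, -⟩ := hbel' y hyK hlt
  have h1 := hball hy k1
  set x := gl h x0 y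
  have hm'M : |m'| ≤ M := by
    rw [abs_le]
    have := hm'.1; have := hm'.2
    constructor <;> linarith [neg_abs_le j1, le_abs_self j2, abs_nonneg j1, abs_nonneg j2]
  have hx1 : |x.1| ≤ C + M * |x.2| := by
    rw [ell_apply] at k2
    calc |x.1| = |(x.1 - m' * x.2) + m' * x.2| := by ring_nf
      _ ≤ |x.1 - m' * x.2| + |m' * x.2| := abs_add_le _ _
      _ ≤ C + M * |x.2| := by
        rw [abs_mul]; exact add_le_add k2 (mul_le_mul_of_nonneg_right hm'M (abs_nonneg _))
  have hC0 : 0 ≤ C := (abs_nonneg _).trans k2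
  have hx : ‖x‖ ≤ C + (M + 1) * |x.2| := by
    rw [Prod.norm_def]
    refine max_le ?_ ?_
    · rw [Real.norm_eq_abs]; nlinarith [abs_nonneg x.2]
    · rw [Real.norm_eq_abs]; nlinarith [abs_nonneg x.2, mul_nonneg hM0 (abs_nonneg x.2)]
  by_contra hn
  push Not at hn
  have : (M + 1) * |x.2| ≤ (M + 1) * |N| :=
    mul_le_mul_of_nonneg_left (hn.trans (le_abs_self _)) (by linarith)
  linarith

theorem half {f h : ℝ × ℝ → ℝ × ℝ} (hp : IsLocalHomeomorph h) {x0 y0 : ℝ × ℝ} {σ : ℝ}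
    (hf : ∀ x, h x = f x - σ • x - y0) (h0 : h x0 = 0)
    {Kc : Set (ℝ × ℝ)} {β : ℝ → ℝ × ℝ} {C e j1 j2 : ℝ} (he : |e| = 1)
    (hK : ∀ u ∈ Kc, ∀ v ∈ Kc, ∀ s t : ℝ, 0 ≤ s → 0 ≤ t → s • u + t • v ∈ Kc)
    (hD : DB h x0 Kc β C e j1 j2) {m m' : ℝ} (hm : m ∈ Ioo j1 j2) (hm' : m' ∈ Ioo j1 j2)
    {N r s η d : ℝ} (hN : 0 ≤ N)
    (hr : ∀ y, dist y (β m) < r → ∀ m' ∈ Ioo j1 j2, y ∈ Kc →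
      e * ell m' y < e * ell m' (β m') → N < |(gl h x0 y).2|)
    (hs : |s| = 1) (hη : 0 < η) (hη1 : η < 1) (hηs : 0 < s * (gl h x0 ((1 - η) • β m)).2)
    (hηr : η * ‖β m‖ + d < r) (hd : (1 + |m|) * d < η * (e * ell m (β m)))
    (hdist : dist (β m') (β m) < d) :
    ∃ V : ℝ → ℝ × ℝ, Continuous V ∧ V 0 = gl h x0 ((1 - η) • β m) ∧
      (∀ τ, N ≤ s * (V τ).2 ∧ ‖f (V τ) - σ • V τ‖ ≤ C + ‖y0‖) ∧
      (0 < s * (m' - m) → Tendsto (fun τ => ell m (V τ)) atTop atTop) ∧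
      (s * (m' - m) < 0 → Tendsto (fun τ => ell m (V τ)) atTop atBot) := by
  set b := β m with hb
  set b' := β m' with hb'
  obtain ⟨bK, -, bpos, -, bbel⟩ := hD m hm
  obtain ⟨bK', -, bpos', -, bbel'⟩ := hD m' hm'
  set k : ℝ → ℝ := fun τ => 1 - η * Real.exp (-max 0 (τ - 1)) with hk
  set θ : ℝ → ℝ := fun τ => max 0 (min 1 τ) with hθ
  set W : ℝ → ℝ × ℝ := fun τ => k τ • (b + θ τ • (b' - b)) with hW
  have hkc : Continuous k := by fun_prop
  have hθc : Continuous θ := by fun_prop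
  have hWc : Continuous W := by fun_prop
  have hk1 : ∀ τ, 1 - η ≤ k τ ∧ k τ < 1 := by
    intro τ
    have h1 : Real.exp (-max 0 (τ - 1)) ≤ 1 := Real.exp_le_one_iff.2 (by simp)
    have h2 := Real.exp_pos (-max 0 (τ - 1))
    simp only [hk]
    constructor <;> nlinarith
  have hθ1 : ∀ τ, 0 ≤ θ τ ∧ θ τ ≤ 1 := fun τ => ⟨le_max_left _ _, max_le zero_le_one (min_le_left _ _)⟩
  have hWK : ∀ τ, W τ ∈ Kc := by
    intro τ
    have h1 : W τ = (k τ * (1 - θ τ)) • b + (k τ * θ τ) • b' := by simp only [hW]; module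
    rw [h1]
    have h2 := hk1 τ; have h3 := hθ1 τ
    exact hK _ bK _ bK' _ _ (mul_nonneg (by linarith) (by linarith)) (mul_nonneg (by linarith) h3.1)
  have hnd : ‖b' - b‖ < d := by rw [← dist_eq_norm]; exact hdist
  have hWd : ∀ τ, dist (W τ) b < r := by
    intro τ
    have h1 : W τ - b = (k τ - 1) • b + (k τ * θ τ) • (b' - b) := by simp only [hW]; module
    rw [dist_eq_norm, h1]
    have h2 := hk1 τ; have h3 := hθ1 τ
    refine (norm_add_le _ _).trans_lt (lt_of_le_of_lt ?_ hηr)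
    rw [norm_smul, norm_smul, Real.norm_eq_abs, Real.norm_eq_abs]
    have h4 : |k τ - 1| ≤ η := by rw [abs_le]; constructor <;> linarith
    have h5 : |k τ * θ τ| ≤ 1 := by
      rw [abs_of_nonneg (mul_nonneg (by linarith) h3.1)]
      nlinarith
    have h6 : |k τ * θ τ| * ‖b' - b‖ ≤ 1 * ‖b' - b‖ := mul_le_mul_of_nonneg_right h5 (norm_nonneg _)
    have h7 : |k τ - 1| * ‖b‖ ≤ η * ‖b‖ := mul_le_mul_of_nonneg_right h4 (norm_nonneg _)
    linarith
  have hW1 : ∀ τ, 1 ≤ τ → W τ = k τ • b' := by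
    intro τ hτ
    have : θ τ = 1 := by simp [hθ, hτ]
    simp only [hW, this]; module
  have hW2 : ∀ τ, 1 ≤ τ → e * ell m' (W τ) < e * ell m' b' := by
    intro τ hτ
    rw [hW1 τ hτ, map_smul, smul_eq_mul]
    nlinarith [mul_lt_mul_of_pos_right (hk1 τ).2 bpos']
  have hbelow : ∀ τ, ∃ m'' ∈ Ioo j1 j2, e * ell m'' (W τ) < e * ell m'' (β m'') := by
    intro τ
    rcases le_total 1 τ with hτ | hτ
    · exact ⟨m', hm', hW2 τ hτ⟩
    · refine ⟨m, hm, ?_⟩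
      have h1 : k τ = 1 - η := by
        simp only [hk]
        rw [max_eq_left (by linarith)]; simp
      have h2 : e * ell m (W τ) = (1 - η) * (e * ell m b) + (1 - η) * θ τ * (e * ell m (b' - b)) := by
        simp only [hW, h1, map_smul, map_add, smul_eq_mul]; ring
      have h3 : e * ell m (b' - b) ≤ (1 + |m|) * d := by
        calc e * ell m (b' - b) ≤ |e * ell m (b' - b)| := le_abs_self _
          _ = |ell m (b' - b)| := by rw [abs_mul, he, one_mul]
          _ ≤ (1 + |m|) * ‖b' - b‖ := abs_ell_le _ _
          _ ≤ (1 + |m|) * d := mul_le_mul_of_nonneg_left hnd.le (by positivity)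
      have hd0 : 0 ≤ (1 + |m|) * d := mul_nonneg (by positivity) ((norm_nonneg _).trans hnd.le)
      have h4 : 0 ≤ (1 - η) * θ τ := mul_nonneg (by linarith) (hθ1 τ).1
      have h5 : (1 - η) * θ τ ≤ 1 := by nlinarith [(hθ1 τ).1, (hθ1 τ).2]
      have h6 : (1 - η) * θ τ * (e * ell m (b' - b)) ≤ (1 + |m|) * d := by
        calc (1 - η) * θ τ * (e * ell m (b' - b)) ≤ (1 - η) * θ τ * ((1 + |m|) * d) :=
              mul_le_mul_of_nonneg_left h3 h4
          _ ≤ 1 * ((1 + |m|) * d) := mul_le_mul_of_nonneg_right h5 hd0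
          _ = _ := one_mul _
      rw [h2]
      linarith
  have hWΩ : ∀ τ, W τ ∈ Om h x0 ∧ ‖W τ‖ ≤ C := by
    intro τ
    obtain ⟨m'', hm'', hlt⟩ := hbelow τ
    obtain ⟨-, -, -, -, hbb⟩ := hD m'' hm''
    obtain ⟨k1, -, k3⟩ := hbb _ (hWK τ) hlt
    exact ⟨k1, k3⟩
  have hWN : ∀ τ, N < |(gl h x0 (W τ)).2| := by
    intro τ
    obtain ⟨m'', hm'', hlt⟩ := hbelow τ
    exact hr _ (hWd τ) m'' hm'' (hWK τ) hlt
  have hVc : Continuous fun τ => gl h x0 (W τ) :=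
    (gl_cont hp).comp_continuous hWc fun τ => (hWΩ τ).1
  have hW0 : W 0 = (1 - η) • b := by simp [hW, hk, hθ]
  have hsign : ∀ τ, s * (gl h x0 (W τ)).2 = |(gl h x0 (W τ)).2| := by
    intro τ
    refine sign_const (S := univ) isPreconnected_univ (g := fun τ => (gl h x0 (W τ)).2)
      (continuous_snd.comp hVc).continuousOn ?_ hs (mem_univ (0:ℝ)) ?_ (mem_univ τ)
    · intro x _ hx
      have := hWN x
      rw [hx] at this
      simp at this
      linarith
    · simp only [hW0]; exact hηs
  have hlim : Tendsto W atTop (𝓝 b') := by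
    have hkl : Tendsto k atTop (𝓝 1) := by
      have h1 : Tendsto (fun τ : ℝ => max 0 (τ - 1)) atTop atTop :=
        tendsto_atTop_mono (fun τ => le_max_right _ _) (tendsto_atTop_add_const_right _ (-1) tendsto_id)
      have h2 : Tendsto (fun τ : ℝ => Real.exp (-max 0 (τ - 1))) atTop (𝓝 0) :=
        Real.tendsto_exp_neg_atTop_nhds_zero.comp h1
      have h3 := (h2.const_mul η).const_sub 1
      simpa using h3
    have h1 : Tendsto (fun τ => k τ • b') atTop (𝓝 ((1:ℝ) • b')) := hkl.smul_const b'
    rw [one_smul] at h1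
    refine h1.congr' ?_
    filter_upwards [eventually_ge_atTop 1] with τ hτ
    exact (hW1 τ hτ).symm
  have hinf : Tendsto (fun τ => s * (gl h x0 (W τ)).2) atTop atTop := by
    rw [Filter.tendsto_atTop]
    intro B
    obtain ⟨r', hr', hB⟩ := DB_blow hp h0 hK hD hm' B
    filter_upwards [(Metric.tendsto_nhds.1 hlim) r' hr'] with τ hτ
    obtain ⟨m'', hm'', hlt⟩ := hbelow τ
    rw [hsign]
    exact (hB _ hτ m'' hm'' (hWK τ) hlt).le
  have hss : s * s = 1 := by
    have := abs_mul_abs_self s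
    rw [hs] at this; linarith
  have hform : ∀ τ, ell m (gl h x0 (W τ)) =
      ell m' (gl h x0 (W τ)) + s * (m' - m) * (s * (gl h x0 (W τ)).2) := by
    intro τ
    rw [ell_apply, ell_apply]
    linear_combination -(m' - m) * (gl h x0 (W τ)).2 * hss
  have hbd : ∀ᶠ τ in atTop, |ell m' (gl h x0 (W τ))| ≤ C := by
    filter_upwards [eventually_ge_atTop 1] with τ hτ
    exact (bbel' _ (hWK τ) (hW2 τ hτ)).2.1
  refine ⟨fun τ => gl h x0 (W τ), hVc, by simp only [hW0], ?_, ?_, ?_⟩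
  · intro τ
    refine ⟨by rw [hsign]; exact (hWN τ).le, ?_⟩
    have h1 := p_gl hp (hWΩ τ).1
    rw [hf] at h1
    have h2 : f (gl h x0 (W τ)) - σ • gl h x0 (W τ) = W τ + y0 := eq_add_of_sub_eq h1
    simp only [h2]
    exact (norm_add_le _ _).trans (by linarith [(hWΩ τ).2])
  · intro hpos
    simp only [hform]
    refine tendsto_atTop_add_left_of_le' _ (-C) ?_ (hinf.const_mul_atTop hpos)
    filter_upwards [hbd] with τ hτ
    exact (abs_le.1 hτ).1
  · intro hneg
    simp only [hform]
    refine tendsto_atBot_add_left_of_ge' _ C ?_ (hinf.const_mul_atTop_of_neg hneg)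
    filter_upwards [hbd] with τ hτ
    exact (abs_le.1 hτ).2

theorem CuBa {f : ℝ × ℝ → ℝ × ℝ} {σ j1 j2 : ℝ} (hDat : Dat f σ j1 j2) :
    ∃ Z : Set ℝ, Z.Countable ∧ ∀ m ∈ Ioo j1 j2, m ∉ Z →
      ∃ s : ℝ, (s = 1 ∨ s = -1) ∧ Cu f σ m s ∧ Ba f σ m s := by
  obtain ⟨h, x0, y0, Kc, β, C, e, he, hp, hf, h0, hK, hD'⟩ := hDat
  have hD : DB h x0 Kc β C e j1 j2 := hD'
  refine ⟨_, (countable_bad (· < ·) (fun a b hab => lt_or_gt_of_ne hab) (Ioo j1 j2) β).union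
    (countable_bad (· > ·) (fun a b hab => (lt_or_gt_of_ne hab).symm) (Ioo j1 j2) β), ?_⟩
  intro m hm hmZ
  rw [mem_union, not_or] at hmZ
  have hlo : ∀ r > 0, ∃ m1 ∈ Ioo j1 j2, m1 < m ∧ dist (β m1) (β m) < r := by
    by_contra hn
    exact hmZ.1 ⟨hm, hn⟩
  have hhi : ∀ r > 0, ∃ m1 ∈ Ioo j1 j2, m1 > m ∧ dist (β m1) (β m) < r := by
    by_contra hn
    exact hmZ.2 ⟨hm, hn⟩
  obtain ⟨bK, -, bpos, bC, bbel⟩ := hD m hm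
  set b := β m with hb
  have hray : ∀ t ∈ Ico (0:ℝ) 1, t • b ∈ Om h x0 ∧ |ell m (gl h x0 (t • b))| ≤ C ∧ ‖t • b‖ ≤ C := by
    intro t ht
    obtain ⟨k1, k2⟩ := DB_ray hK hD hm ht
    exact bbel _ k1 k2
  set γ : ℝ → ℝ × ℝ := fun t => gl h x0 (t • b) with hγ
  have hγc : ContinuousOn γ (Ico 0 1) :=
    (gl_cont hp).comp (by fun_prop) fun t ht => (hray t ht).1
  have hblow : ∀ N : ℝ, ∃ t0 ∈ Ico (0:ℝ) 1, ∀ t ∈ Ico t0 1, N < |(γ t).2| := by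
    intro N
    obtain ⟨r, hr, hB⟩ := DB_blow hp h0 hK hD hm N
    have hcts : Continuous fun t : ℝ => t • b := by fun_prop
    have h1 : ∀ᶠ t in 𝓝 (1:ℝ), dist (t • b) b < r := by
      have := hcts.continuousAt (x := (1:ℝ))
      rw [ContinuousAt, one_smul] at this
      exact Metric.tendsto_nhds.1 this r hr
    obtain ⟨d, hd, hd'⟩ := Metric.eventually_nhds_iff.1 h1
    refine ⟨max 0 (1 - d / 2), ⟨le_max_left _ _, max_lt zero_lt_one (by linarith)⟩, ?_⟩
    intro t ht
    have t0 : 0 ≤ t := (le_max_left _ _).trans ht.1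
    have t1 : 1 - d / 2 ≤ t := (le_max_right _ _).trans ht.1
    obtain ⟨k1, k2⟩ := DB_ray hK hD hm ⟨t0, ht.2⟩
    refine hB _ (hd' ?_) m hm k1 k2
    rw [Real.dist_eq, abs_lt]
    constructor <;> linarith [ht.2]
  obtain ⟨t0, ht0, hb0⟩ := hblow 0
  have hne : ∀ t ∈ Ico t0 1, (γ t).2 ≠ 0 := fun t ht => abs_pos.1 (hb0 t ht)
  obtain ⟨s, hs, hs0⟩ : ∃ s : ℝ, (s = 1 ∨ s = -1) ∧ 0 < s * (γ t0).2 := by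
    rcases lt_or_gt_of_ne (hne t0 ⟨le_rfl, ht0.2⟩) with h1 | h1
    · exact ⟨-1, Or.inr rfl, by linarith⟩
    · exact ⟨1, Or.inl rfl, by linarith⟩
  have hs1 : |s| = 1 := by rcases hs with rfl | rfl <;> simp
  have hsg : ∀ t ∈ Ico t0 1, s * (γ t).2 = |(γ t).2| := by
    intro t ht
    refine sign_const (S := Ico t0 1) isPreconnected_Ico (g := fun t => (γ t).2) ?_ hne hs1
      (⟨le_rfl, ht0.2⟩ : t0 ∈ Ico t0 1) hs0 ht
    exact continuous_snd.comp_continuousOn (hγc.mono (Ico_subset_Ico_left ht0.1))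
  refine ⟨s, hs, ?_, ?_⟩
  · refine ⟨γ, C + ‖y0‖, hγc, ?_, ?_⟩
    · intro t ht
      obtain ⟨k1, k2, k3⟩ := hray t ht
      refine ⟨k2.trans (by linarith [norm_nonneg y0]), ?_⟩
      have h1 := p_gl hp k1
      rw [hf] at h1
      have h2 : f (γ t) - σ • γ t = t • b + y0 := eq_add_of_sub_eq h1
      rw [h2]
      exact (norm_add_le _ _).trans (by linarith)
    · intro B
      obtain ⟨t1, ht1, hB⟩ := hblow B
      have hmx : max t0 t1 < 1 := max_lt ht0.2 ht1.2
      refine ⟨max t0 t1, ⟨ht0.1.trans (le_max_left _ _), hmx⟩, ?_⟩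
      rw [hsg _ ⟨le_max_left _ _, hmx⟩]
      exact hB _ ⟨le_max_right _ _, hmx⟩
  · refine ⟨C + ‖y0‖, fun N => ?_⟩
    obtain ⟨r, hr, hB⟩ := DB_blow hp h0 hK hD hm (max N 0)
    set η := min ((1 - t0) / 2) (r / (2 * (‖b‖ + 1))) with hη
    have hbn : 0 < ‖b‖ + 1 := by positivity
    have hη0 : 0 < η := lt_min (by linarith [ht0.2]) (by positivity)
    have hηt : η ≤ (1 - t0) / 2 := min_le_left _ _
    have hη1 : η < 1 := by linarith [ht0.1]
    have hηr : η * (‖b‖ + 1) ≤ r / 2 := by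
      have : η ≤ r / (2 * (‖b‖ + 1)) := min_le_right _ _
      calc η * (‖b‖ + 1) ≤ r / (2 * (‖b‖ + 1)) * (‖b‖ + 1) := mul_le_mul_of_nonneg_right this hbn.le
        _ = r / 2 := by field_simp
    have hηs : 0 < s * (gl h x0 ((1 - η) • b)).2 := by
      have hmem : 1 - η ∈ Ico t0 1 := ⟨by linarith [ht0.2], by linarith⟩
      have h1 := hsg _ hmem
      have h2 := hb0 _ hmem
      rw [← h1] at h2
      exact h2
    set d := min (r / 2) (η * (e * ell m b) / (2 * (1 + |m|))) with hd
    have hp1 : 0 < 1 + |m| := by positivity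
    have hd0 : 0 < d := lt_min (by linarith) (by positivity)
    have hd1 : η * ‖b‖ + d < r := by
      have : d ≤ r / 2 := min_le_left _ _
      nlinarith
    have hd2 : (1 + |m|) * d < η * (e * ell m b) := by
      have h1 : d ≤ η * (e * ell m b) / (2 * (1 + |m|)) := min_le_right _ _
      have h2 : (1 + |m|) * d ≤ η * (e * ell m b) / 2 := by
        calc (1 + |m|) * d ≤ (1 + |m|) * (η * (e * ell m b) / (2 * (1 + |m|))) :=
              mul_le_mul_of_nonneg_left h1 hp1.le
          _ = _ := by field_simp
      have h3 : 0 < η * (e * ell m b) := mul_pos hη0 bpos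
      linarith
    obtain ⟨mp, hmp, hmpd, hmps⟩ : ∃ m1 ∈ Ioo j1 j2, dist (β m1) b < d ∧ 0 < s * (m1 - m) := by
      rcases hs with rfl | rfl
      · obtain ⟨m1, h1, h2, h3⟩ := hhi d hd0
        exact ⟨m1, h1, h3, by linarith⟩
      · obtain ⟨m1, h1, h2, h3⟩ := hlo d hd0
        exact ⟨m1, h1, h3, by linarith⟩
    obtain ⟨mn, hmn, hmnd, hmns⟩ : ∃ m1 ∈ Ioo j1 j2, dist (β m1) b < d ∧ s * (m1 - m) < 0 := by
      rcases hs with rfl | rfl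
      · obtain ⟨m1, h1, h2, h3⟩ := hlo d hd0
        exact ⟨m1, h1, h3, by linarith⟩
      · obtain ⟨m1, h1, h2, h3⟩ := hhi d hd0
        exact ⟨m1, h1, h3, by linarith⟩
    obtain ⟨P, Pc, P0, Pb, Pt, -⟩ := half hp hf h0 he hK hD hm hmp (le_max_right N 0) hB hs1 hη0 hη1 hηs
      hd1 hd2 hmpd
    obtain ⟨Q, Qc, Q0, Qb, -, Qt⟩ := half hp hf h0 he hK hD hm hmn (le_max_right N 0) hB hs1 hη0 hη1 hηs
      hd1 hd2 hmnd
    have Pt := Pt hmps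
    have Qt := Qt hmns
    set v : ℝ → ℝ × ℝ := fun τ => Q (max 0 (-τ)) + P (max 0 τ) - gl h x0 ((1 - η) • b) with hv
    have v1 : ∀ τ, 0 ≤ τ → v τ = P τ := by
      intro τ hτ
      simp only [hv]
      rw [max_eq_left (by linarith : -τ ≤ 0), max_eq_right hτ, Q0]; abel
    have v2 : ∀ τ, τ ≤ 0 → v τ = Q (-τ) := by
      intro τ hτ
      simp only [hv]
      rw [max_eq_right (by linarith : 0 ≤ -τ), max_eq_left hτ, P0]; abel
    refine ⟨v, by fun_prop, ?_, ?_, ?_⟩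
    · intro τ
      rcases le_total 0 τ with hτ | hτ
      · rw [v1 τ hτ]; exact ⟨(le_max_left N 0).trans (Pb τ).1, (Pb τ).2⟩
      · rw [v2 τ hτ]; exact ⟨(le_max_left N 0).trans (Qb (-τ)).1, (Qb (-τ)).2⟩
    · refine Pt.congr' ?_
      filter_upwards [eventually_ge_atTop 0] with τ hτ
      rw [v1 τ hτ]
    · refine (Qt.comp tendsto_neg_atBot_atTop).congr' ?_
      filter_upwards [eventually_le_atBot 0] with τ hτ
      rw [v2 τ hτ]; rfl


theorem dat_of_noninj {f : ℝ × ℝ → ℝ × ℝ} {f' : ℝ × ℝ → (ℝ × ℝ) →L[ℝ] (ℝ × ℝ)}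
    (hf : ∀ p, HasFDerivAt f (f' p) p) {ε : ℝ}
    (hev : ∀ p, ∀ l : ℝ, 0 ≤ l → l < ε → ∀ v, f' p v = l • v → v = 0)
    {σ : ℝ} (hσ : 0 < σ) (hσε : σ < ε) (hni : ¬ Injective fun x => f x - σ • x) :
    ∃ j : ℚ × ℚ, j.1 < j.2 ∧ Dat f σ j.1 j.2 := by
  set g : ℝ × ℝ → ℝ × ℝ := fun x => f x - σ • x with hg
  set g' : ℝ × ℝ → (ℝ × ℝ) →L[ℝ] (ℝ × ℝ) := fun p => f' p - σ • ContinuousLinearMap.id ℝ (ℝ × ℝ) with hg'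
  have hgd : ∀ p, HasFDerivAt g (g' p) p := fun p => (hf p).sub ((hasFDerivAt_id p).const_smul σ)
  have hg'v : ∀ p v, g' p v = f' p v - σ • v := fun p v => by simp [hg']
  have hδ : 0 < min σ (ε - σ) := lt_min hσ (by linarith)
  have hgev : ∀ p, ∀ l : ℝ, |l| < min σ (ε - σ) → ∀ v, g' p v = l • v → v = 0 := by
    intro p l hl v hv
    rw [lt_min_iff, abs_lt, abs_lt] at hl
    refine hev p (σ + l) (by linarith) (by linarith) v ?_
    rw [hg'v, sub_eq_iff_eq_add] at hv
    rw [hv]; module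
  have hgl : IsLocalHomeomorph g := isLocHomeo hgd fun p v hv =>
    hgev p 0 (by simpa using hδ) v (by simpa using hv)
  obtain ⟨x0, hx0⟩ : ∃ x0, ¬ Convex ℝ (Om g x0) := by
    by_contra hn
    push Not at hn
    exact hni (inj_of_convex hgl hn)
  set h : ℝ × ℝ → ℝ × ℝ := fun x => g x - g x0 with hh
  have hhd : ∀ p, HasFDerivAt h (g' p) p := fun p => (hgd p).sub_const _
  have hhl : IsLocalHomeomorph h := isLocHomeo hhd fun p v hv =>
    hgev p 0 (by simpa using hδ) v (by simpa using hv)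
  have h0 : h x0 = 0 := by simp [hh]
  have hOm : Om g x0 = (fun y => y - g x0) ⁻¹' Om h x0 := by
    ext y
    constructor
    · rintro ⟨Γ, h1, h2⟩
      refine ⟨Γ, h1, fun t => ?_⟩
      rw [h0, zero_add, sub_zero]
      simp only [hh]
      rw [h2 t]; abel
    · rintro ⟨Γ, h1, h2⟩
      refine ⟨Γ, h1, fun t => ?_⟩
      have := h2 t
      rw [h0, zero_add, sub_zero] at this
      simp only [hh] at this
      rw [← this]; abel
  have hnc : ¬ Convex ℝ (Om h x0) := by
    intro hc
    apply hx0
    rw [hOm]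
    have := hc.translate_preimage_left (-g x0)
    simpa [sub_eq_add_neg] using this
  obtain ⟨j1, j2, h1, h2⟩ := mk_Dat (f := f) (y0 := g x0) (σ := σ) hhd hhl (fun x => rfl) h0 hδ hgev hnc
  exact ⟨(j1, j2), h1, h2⟩

theorem perturb {f : ℝ × ℝ → ℝ × ℝ} {f' : ℝ × ℝ → (ℝ × ℝ) →L[ℝ] (ℝ × ℝ)}
    (hf : ∀ p, HasFDerivAt f (f' p) p) (hinj : ∀ p v, f' p v = 0 → v = 0) (hni : ¬ Injective f) :
    ∃ σ0 : ℝ, 0 < σ0 ∧ ∀ σ : ℝ, 0 < σ → σ < σ0 → ¬ Injective fun x => f x - σ • x := by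
  simp only [Injective] at hni
  push Not at hni
  obtain ⟨p, q, hpq, hne⟩ := hni
  have hd : 0 < dist p q := dist_pos.2 hne
  obtain ⟨ρ, hρ, r', hr', hr'r, hsol⟩ := solve (hf p) (hinj p) (half_pos hd)
  have hpos : 0 < r' + dist p q := by positivity
  refine ⟨ρ / (r' + dist p q), by positivity, fun σ hσ hσ' hI => ?_⟩
  have hfc : Continuous f := continuous_iff_continuousAt.2 fun x => (hf x).continuousAt
  obtain ⟨x, hx, hGx⟩ := hsol (fun x => f x - σ • (x - q)) (by fun_prop) (by
    intro x hx
    have h1 : f x - σ • (x - q) - f x = -(σ • (x - q)) := by abel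
    rw [h1, norm_neg, norm_smul, Real.norm_eq_abs, abs_of_pos hσ, ← dist_eq_norm]
    have h2 : dist x q ≤ r' + dist p q := (dist_triangle x p q).trans (by
      have := mem_closedBall.1 hx
      linarith)
    rw [lt_div_iff₀ hpos] at hσ'
    nlinarith)
  have : x = q := by
    apply hI
    simp only at hGx ⊢
    rw [hpq, smul_sub] at hGx
    rw [← hGx]; abel
  rw [this, mem_closedBall, dist_comm] at hx
  linarith

theorem exists_mem_Ioo_not_mem {a b : ℝ} (hab : a < b) {Z : Set ℝ} (hZ : Z.Countable) :
    ∃ m ∈ Ioo a b, m ∉ Z := by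
  obtain ⟨c, hc, h1⟩ := (hZ.dense_compl ℝ).exists_between hab
  exact ⟨c, h1, hc⟩

theorem main_inj {f : ℝ × ℝ → ℝ × ℝ} {f' : ℝ × ℝ → (ℝ × ℝ) →L[ℝ] (ℝ × ℝ)}
    (hf : ∀ p, HasFDerivAt f (f' p) p) {ε : ℝ} (hε : 0 < ε)
    (hev : ∀ p, ∀ l : ℝ, 0 ≤ l → l < ε → ∀ v, f' p v = l • v → v = 0) : Injective f := by
  by_contra hni
  obtain ⟨σ0, hσ0, hper⟩ := perturb hf
    (fun p v hv => hev p 0 le_rfl hε v (by simpa using hv)) hni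
  set S : ℚ × ℚ → Set ℝ := fun j => {σ | j.1 < j.2 ∧ Dat f σ j.1 j.2} with hS
  have hcov : Ioo 0 (min σ0 ε) ⊆ ⋃ j, S j := by
    intro σ hσ
    have h2 := lt_min_iff.1 hσ.2
    obtain ⟨j, hj⟩ := dat_of_noninj hf hev hσ.1 h2.2 (hper σ hσ.1 h2.1)
    exact mem_iUnion.2 ⟨j, hj⟩
  obtain ⟨j, hj⟩ : ∃ j, (S j).Infinite := by
    by_contra hn
    simp only [Set.Infinite] at hn
    push Not at hn
    have hc : (⋃ j, S j).Countable := countable_iUnion fun j => (hn j).countable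
    obtain ⟨m, hm, hm'⟩ := exists_mem_Ioo_not_mem (lt_min hσ0 hε) hc
    exact hm' (hcov hm)
  obtain ⟨t, htS, htc⟩ := hj.exists_subset_card_eq 3
  obtain ⟨a, b, c, hab, hac, hbc, rfl⟩ := Finset.card_eq_three.1 htc
  obtain ⟨hj12, ha⟩ : a ∈ S j := htS (by simp)
  obtain ⟨-, hb⟩ : b ∈ S j := htS (by simp)
  obtain ⟨-, hc⟩ : c ∈ S j := htS (by simp)
  obtain ⟨Za, Zac, ha⟩ := CuBa ha
  obtain ⟨Zb, Zbc, hb⟩ := CuBa hb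
  obtain ⟨Zc, Zcc, hc⟩ := CuBa hc
  obtain ⟨m, hm, hmZ⟩ := exists_mem_Ioo_not_mem (show (j.1 : ℝ) < j.2 by exact_mod_cast hj12)
    ((Zac.union Zbc).union Zcc)
  simp only [mem_union, not_or] at hmZ
  obtain ⟨sa, hsa, a1, a2⟩ := ha m hm hmZ.1.1
  obtain ⟨sb, hsb, b1, b2⟩ := hb m hm hmZ.1.2
  obtain ⟨sc, hsc, c1, c2⟩ := hc m hm hmZ.2
  have p1 : |(1:ℝ)| = 1 := by simp
  have p2 : |(-1:ℝ)| = 1 := by simp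
  rcases hsa with rfl | rfl <;> rcases hsb with rfl | rfl <;> rcases hsc with rfl | rfl
  · exact crossing p1 hab b1 a2
  · exact crossing p1 hab b1 a2
  · exact crossing p1 hac c1 a2
  · exact crossing p2 hbc c1 b2
  · exact crossing p1 hbc c1 b2
  · exact crossing p2 hac c1 a2
  · exact crossing p2 hab b1 a2
  · exact crossing p2 hab b1 a2

theorem ev_of_vec (L : Plane →L[ℝ] Plane) (l : ℝ) (v : Plane) (hv : v ≠ 0) (h : L v = l • v) :
    IsEigenvalueCLM L (l : ℂ) := by
  unfold IsEigenvalueCLM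
  rw [Matrix.charpoly_map, LinearMap.charpoly_toMatrix]
  have h1 : Module.End.HasEigenvalue L.toLinearMap l :=
    Module.End.hasEigenvalue_of_hasEigenvector (x := v)
      ⟨Module.End.mem_eigenspace_iff.2 (by simpa using h), hv⟩
  exact (Module.End.hasEigenvalue_iff_isRoot_charpoly L.toLinearMap l).1 h1 |>.map

theorem plane_main (f : Plane → Plane) (Df : Plane → Plane →L[ℝ] Plane)
    (hdiff : ∀ p : Plane, HasFDerivAt f (Df p) p) (ε : ℝ) (hε : 0 < ε)
    (hev : ∀ p, ∀ l : ℝ, 0 ≤ l → l < ε → ∀ v, Df p v = l • v → v = 0) :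
    IsOpenEmbedding f := by
  let Φ : Plane ≃L[ℝ] ℝ × ℝ :=
    ContinuousLinearEquiv.ofFinrankEq (by simp)
  let F : ℝ × ℝ → ℝ × ℝ := fun x => Φ (f (Φ.symm x))
  let F' : ℝ × ℝ → (ℝ × ℝ) →L[ℝ] (ℝ × ℝ) := fun x =>
    (Φ : Plane →L[ℝ] ℝ × ℝ).comp ((Df (Φ.symm x)).comp (Φ.symm : (ℝ × ℝ) →L[ℝ] Plane))
  have hF : ∀ p, HasFDerivAt F (F' p) p := fun p =>
    Φ.hasFDerivAt.comp p ((hdiff (Φ.symm p)).comp p Φ.symm.hasFDerivAt)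
  have hFev : ∀ p, ∀ l : ℝ, 0 ≤ l → l < ε → ∀ v, F' p v = l • v → v = 0 := by
    intro p l h0 h1 v hv
    have h2 : Φ (Df (Φ.symm p) (Φ.symm v)) = l • v := hv
    have h3 : Df (Φ.symm p) (Φ.symm v) = l • Φ.symm v := by
      apply Φ.injective
      rw [h2, map_smul]; simp
    have h4 := hev _ l h0 h1 _ h3
    simpa using h4
  have hinj := main_inj hF hε hFev
  have hloc := isLocHomeo hF fun p v hv => hFev p 0 le_rfl hε v (by simpa using hv)
  have hO : IsOpenEmbedding F := hloc.isOpenEmbedding_of_injective hinj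
  have hfe : f = Φ.symm ∘ F ∘ Φ := by
    funext x; simp [F]
  rw [hfe]
  exact Φ.symm.toHomeomorph.isOpenEmbedding.comp (hO.comp Φ.toHomeomorph.isOpenEmbedding)

/-- A differentiable map of the plane fixing the origin with
`Spec(f) ∩ ([0, ε) ∪ [1, 1+ε)) = ∅` is a topological embedding with `Fix(f) = {0}`. -/
theorem stmt4 (f : Plane → Plane) (Df : Plane → Plane →L[ℝ] Plane)
    (hdiff : ∀ p : Plane, HasFDerivAt f (Df p) p)
    (h0 : f 0 = 0)
    (ε : ℝ) (hε : 0 < ε)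
    (hspec : spec Df ∩ (Complex.ofReal '' (Ico (0 : ℝ) ε ∪ Ico (1 : ℝ) (1 + ε))) = ∅) :
    Topology.IsEmbedding f ∧ {p : Plane | f p = p} = {0} := by
  have key : ∀ p, ∀ l ∈ Ico (0 : ℝ) ε ∪ Ico (1 : ℝ) (1 + ε), ∀ v, Df p v = l • v → v = 0 := by
    intro p l hl v hv
    by_contra hv0
    have : (l : ℂ) ∈ spec Df ∩ (Complex.ofReal '' (Ico (0 : ℝ) ε ∪ Ico (1 : ℝ) (1 + ε))) :=
      ⟨⟨p, ev_of_vec _ l v hv0 hv⟩, l, hl, rfl⟩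
    rw [hspec] at this
    exact this
  have h1 : IsOpenEmbedding f := plane_main f Df hdiff ε hε fun p l hl hl' v hv =>
    key p l (Or.inl ⟨hl, hl'⟩) v hv
  have h2 : IsOpenEmbedding fun x => f x - x :=
    plane_main _ (fun p => Df p - ContinuousLinearMap.id ℝ Plane)
      (fun p => (hdiff p).sub (hasFDerivAt_id p)) ε hε fun p l hl hl' v hv => by
        refine key p (1 + l) (Or.inr ⟨by linarith, by linarith⟩) v ?_
        have h3 : Df p v - v = l • v := by simpa using hv
        rw [sub_eq_iff_eq_add] at h3
        rw [h3, add_smul, one_smul, add_comm]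
  refine ⟨h1.isEmbedding, ?_⟩
  ext p
  constructor
  · intro hp
    have hp' : f p = p := hp
    have : p = 0 := h2.injective (by simp [hp', h0])
    exact this
  · intro hp
    have hp' : p = 0 := hp
    show f p = p
    rw [hp', h0]
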